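/- Assuming the Riemann hypothesis, for all real x ≥ 3000 one has |∫_2^x (ψ(t) − t) dt| ≤ 0.08·x^{3/2}. -/

import Mathlib

open MeasureTheory Filter

/-- `psi x = ∑_{p^m ≤ x} log p`, the Chebyshev psi function. -/
noncomputable def psi (x : ℝ) : ℝ :=
  ∑ n ∈ Finset.Icc 1 ⌊x⌋₊, ArithmeticFunction.vonMangoldt n

namespace PsiRH
open Complex Topology

/-- derivative of log Gamma on the positive reals -/
noncomputable def dG (x : ℝ) : ℝ := deriv (Real.log ∘ Real.Gamma) x

lemma logGamma_diff {x : ℝ} (hx : 0 < x) : DifferentiableAt ℝ (Real.log ∘ Real.Gamma) x := by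
  have h1 : DifferentiableAt ℝ Real.Gamma x :=
    Real.differentiableAt_Gamma fun m => ((neg_nonpos.mpr m.cast_nonneg).trans_lt hx).ne'
  exact (Real.differentiableAt_log (Real.Gamma_pos_of_pos hx).ne').comp x h1

lemma dG_mono : MonotoneOn dG (Set.Ioi 0) :=
  Real.convexOn_log_Gamma.monotoneOn_deriv fun _ hx => logGamma_diff hx

lemma dG_add_one {x : ℝ} (hx : 0 < x) : dG (x + 1) = dG x + 1 / x := by
  have h1 : HasDerivAt (fun y => (Real.log ∘ Real.Gamma) (y + 1)) (dG (x+1)) x := by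
    have := (logGamma_diff (by linarith : 0 < x + 1)).hasDerivAt
    exact this.comp_add_const x 1
  have h2 : HasDerivAt (fun y => (Real.log ∘ Real.Gamma) y + Real.log y) (dG x + 1 / x) x := by
    rw [one_div]
    exact (logGamma_diff hx).hasDerivAt.add (Real.hasDerivAt_log hx.ne')
  have h3 : (fun y => (Real.log ∘ Real.Gamma) (y + 1)) =ᶠ[𝓝 x]
      (fun y => (Real.log ∘ Real.Gamma) y + Real.log y) := by
    filter_upwards [lt_mem_nhds hx] with y hy
    simp only [Function.comp]
    rw [Real.Gamma_add_one hy.ne', Real.log_mul hy.ne' (Real.Gamma_pos_of_pos hy).ne', add_comm]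
  exact h1.unique (h2.congr_of_eventuallyEq h3)

lemma dG_add_nat {x : ℝ} (hx : 0 < x) (N : ℕ) :
    dG (x + N) = dG x + ∑ k ∈ Finset.range N, 1 / (x + k) := by
  induction N with
  | zero => simp
  | succ n ih =>
    rw [Finset.sum_range_succ, ← add_assoc, ← ih, ← dG_add_one (by positivity)]
    push_cast; ring_nf

lemma dG_one : dG 1 = -Real.eulerMascheroniConstant := by
  have := (Real.hasDerivAt_log (x := Real.Gamma 1) (by simp)).comp 1 Real.hasDerivAt_Gamma_one
  unfold dG
  rw [this.deriv]; simp

lemma dG_hasSum {y : ℝ} (hy : 0 < y) :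
    HasSum (fun n : ℕ => 1 / ((n:ℝ) + 1) - 1 / (n + 1 + y)) (dG (1 + y) - dG 1) := by
  rw [hasSum_iff_tendsto_nat_of_nonneg]
  swap
  · intro n
    rw [sub_nonneg]
    apply one_div_le_one_div_of_le <;> linarith [(Nat.cast_nonneg n : (0:ℝ) ≤ n)]
  obtain ⟨M, hM⟩ := exists_nat_ge y
  have key : ∀ N : ℕ, ∑ i ∈ Finset.range N, (1 / ((i:ℝ) + 1) - 1 / (i + 1 + y))
      = (dG (1 + y) - dG 1) - (dG (1 + y + N) - dG (1 + N)) := by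
    intro N
    rw [dG_add_nat (by linarith) N, dG_add_nat one_pos N, Finset.sum_sub_distrib]
    have e1 : ∀ i : ℕ, 1 / ((i:ℝ) + 1) = 1 / (1 + i) := fun i => by rw [add_comm]
    have e2 : ∀ i : ℕ, 1 / ((i:ℝ) + 1 + y) = 1 / (1 + y + i) := fun i => by congr 1; ring
    simp_rw [e1, e2]; ring
  simp_rw [key]
  have hz : Tendsto (fun N : ℕ => dG (1 + y + N) - dG (1 + N)) atTop (𝓝 0) := by
    refine tendsto_of_tendsto_of_tendsto_of_le_of_le (h := fun N : ℕ => (M:ℝ) * (1 / ((N:ℝ) + 1)))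
      tendsto_const_nhds ?_ ?_ ?_
    · simpa using (tendsto_one_div_add_atTop_nhds_zero_nat (𝕜 := ℝ)).const_mul (M:ℝ)
    · intro N
      have : (0:ℝ) ≤ N := Nat.cast_nonneg N
      have := dG_mono (a := 1 + N) (b := 1 + y + N) (by simp; linarith) (by simp; linarith) (by linarith)
      simpa using this
    · intro N
      have hN : (0:ℝ) ≤ N := Nat.cast_nonneg N
      have h1 := dG_mono (a := 1 + y + N) (b := 1 + N + M) (by simp; linarith) (by simp; linarith)
        (by linarith)
      rw [dG_add_nat (by linarith) M] at h1
      have h2 : ∑ k ∈ Finset.range M, 1 / (1 + (N:ℝ) + k) ≤ ∑ k ∈ Finset.range M, 1 / ((N:ℝ) + 1) := by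
        apply Finset.sum_le_sum
        intro k _
        apply one_div_le_one_div_of_le <;> linarith [(Nat.cast_nonneg k : (0:ℝ) ≤ k)]
      simp only [Finset.sum_const, Finset.card_range, nsmul_eq_mul] at h2
      simp only
      linarith
  simpa using (tendsto_const_nhds (x := dG (1 + y) - dG 1)).sub hz

/-- a digamma type series, regular in the right half plane -/
noncomputable def D (s : ℂ) : ℂ := ∑' n : ℕ, (1 / (2 * ((n:ℂ) + 1)) - 1 / (2 * ((n:ℂ) + 1) + s))

lemma digamma_ofReal {y : ℝ} (hy : 0 < y) : digamma (y : ℂ) = (dG y : ℂ) := by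
  have h1 : HasDerivAt Complex.Gamma (deriv Complex.Gamma y) (y:ℂ) :=
    (differentiableAt_Gamma _ fun m h => by
      have := congrArg Complex.re h
      simp at this
      linarith [(Nat.cast_nonneg m : (0:ℝ) ≤ m)]).hasDerivAt
  have h2 := h1.comp_ofReal
  have h3 : HasDerivAt Real.Gamma (deriv Real.Gamma y) y :=
    (Real.differentiableAt_Gamma fun m => ((neg_nonpos.mpr m.cast_nonneg).trans_lt hy).ne').hasDerivAt
  have h4 : HasDerivAt (fun t : ℝ => Complex.Gamma t) ((deriv Real.Gamma y : ℝ) : ℂ) y := by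
    have := h3.ofReal_comp
    simpa [Complex.Gamma_ofReal] using this
  have h5 := h2.unique h4
  have h6 : dG y = deriv Real.Gamma y / Real.Gamma y := by
    have := (Real.hasDerivAt_log (Real.Gamma_pos_of_pos hy).ne').comp y h3
    unfold dG
    rw [this.deriv]; field_simp
  rw [digamma_def, logDeriv_apply, h5, h6, Complex.Gamma_ofReal]
  push_cast; rfl

lemma two_mul_re_pos {s : ℂ} (hs : 0 < s.re) (n : ℕ) : 0 < (2 * ((n:ℂ) + 1) + s).re := by
  simp; positivity

lemma D_term_bound {s : ℂ} (hs : 0 < s.re) (n : ℕ) :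
    ‖1 / (2 * ((n:ℂ) + 1)) - 1 / (2 * ((n:ℂ) + 1) + s)‖
      ≤ Real.sqrt ‖s‖ * (1 / ((n:ℝ) + 1) ^ ((3:ℝ)/2)) := by
  have hp := two_mul_re_pos hs n
  have hne : (2 * ((n:ℂ) + 1) + s) ≠ 0 := fun h => by rw [h] at hp; simp at hp
  have hne1 : (2 * ((n:ℂ) + 1)) ≠ 0 := by
    have : ((n:ℂ) + 1) ≠ 0 := Nat.cast_add_one_ne_zero n
    simpa using this
  have e : 1 / (2 * ((n:ℂ) + 1)) - 1 / (2 * ((n:ℂ) + 1) + s)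
      = s / ((2 * ((n:ℂ) + 1)) * (2 * ((n:ℂ) + 1) + s)) := by field_simp; ring
  have hm : (0:ℝ) < (n:ℝ) + 1 := by positivity
  have n1 : ‖(2 * ((n:ℂ) + 1))‖ = 2 * ((n:ℝ) + 1) := by
    have : (2 * ((n:ℂ) + 1)) = ((2 * ((n:ℝ) + 1) : ℝ) : ℂ) := by push_cast; ring
    rw [this, Complex.norm_real, Real.norm_of_nonneg (by positivity)]
  set N := ‖2 * ((n:ℂ) + 1) + s‖ with hN
  have hsq : N ^ 2 = (2 * ((n:ℝ) + 1) + s.re) ^ 2 + s.im ^ 2 := by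
    rw [hN, Complex.sq_norm, Complex.normSq_apply]; simp; ring
  have hs2 : ‖s‖ ^ 2 = s.re ^ 2 + s.im ^ 2 := by
    rw [Complex.sq_norm, Complex.normSq_apply]; ring
  have N0 : 0 ≤ N := norm_nonneg _
  have s0 : 0 < ‖s‖ := norm_pos_iff.mpr (fun h => by rw [h] at hs; simp at hs)
  have a1 : (n:ℝ) + 1 ≤ N := by
    apply le_of_sq_le_sq _ N0
    rw [hsq]; nlinarith [sq_nonneg s.im, mul_pos hm hs]
  have a2 : ‖s‖ ≤ N := by
    apply le_of_sq_le_sq _ N0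
    rw [hsq, hs2]; nlinarith [mul_pos hm hs]
  have a3 : Real.sqrt ((n:ℝ)+1) * Real.sqrt ‖s‖ ≤ N := by
    rw [← Real.sqrt_mul hm.le]
    apply Real.sqrt_le_iff.mpr ⟨N0, by nlinarith⟩
  rw [e, norm_div, norm_mul, n1, ← hN]
  have r32 : ((n:ℝ) + 1) ^ ((3:ℝ)/2) = ((n:ℝ)+1) * Real.sqrt ((n:ℝ)+1) := by
    rw [Real.sqrt_eq_rpow, show (3:ℝ)/2 = 1 + 1/2 by norm_num, Real.rpow_add hm, Real.rpow_one]
  rw [r32]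
  have q1 : 0 < Real.sqrt ((n:ℝ)+1) := Real.sqrt_pos.mpr hm
  have q2 : 0 < Real.sqrt ‖s‖ := Real.sqrt_pos.mpr s0
  have q3 : Real.sqrt ‖s‖ * Real.sqrt ‖s‖ = ‖s‖ := Real.mul_self_sqrt s0.le
  rw [mul_one_div, div_le_div_iff₀ (by nlinarith) (by positivity)]
  calc ‖s‖ * (((n:ℝ)+1) * Real.sqrt ((n:ℝ)+1))
      = Real.sqrt ‖s‖ * ((n:ℝ)+1) * (Real.sqrt ((n:ℝ)+1) * Real.sqrt ‖s‖) := by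
        linear_combination -(((n:ℝ)+1) * Real.sqrt ((n:ℝ)+1)) * q3
    _ ≤ Real.sqrt ‖s‖ * ((n:ℝ)+1) * N := by gcongr
    _ ≤ Real.sqrt ‖s‖ * (2 * ((n:ℝ)+1) * N) := by
        have : 0 ≤ Real.sqrt ‖s‖ * ((n:ℝ)+1) * N := by positivity
        nlinarith

lemma summable_32 : Summable (fun n : ℕ => 1 / ((n:ℝ) + 1) ^ ((3:ℝ)/2)) := by
  have := (summable_nat_add_iff 1).mpr (Real.summable_one_div_nat_rpow.mpr (by norm_num : (1:ℝ) < 3/2))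
  simpa using this

lemma D_summable {s : ℂ} (hs : 0 < s.re) :
    Summable (fun n : ℕ => 1 / (2 * ((n:ℂ) + 1)) - 1 / (2 * ((n:ℂ) + 1) + s)) :=
  Summable.of_norm_bounded (summable_32.mul_left _) (D_term_bound hs)

lemma D_bound : ∃ B : ℝ, 0 ≤ B ∧ ∀ s : ℂ, 0 < s.re → ‖D s‖ ≤ B * Real.sqrt ‖s‖ := by
  refine ⟨∑' n : ℕ, 1 / ((n:ℝ) + 1) ^ ((3:ℝ)/2), tsum_nonneg fun n => by positivity, fun s hs => ?_⟩
  rw [mul_comm, ← tsum_mul_left]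
  exact tsum_of_norm_bounded (summable_32.mul_left _).hasSum (D_term_bound hs)

lemma D_diffOn : DifferentiableOn ℂ D {s | 0 < s.re} := by
  have hopen : IsOpen {s : ℂ | 0 < s.re} := isOpen_lt continuous_const Complex.continuous_re
  intro s hs
  have hs' : 0 < s.re := hs
  set U : Set ℂ := {z | 0 < z.re} ∩ Metric.ball 0 (‖s‖ + 1)
  have hU : IsOpen U := hopen.inter Metric.isOpen_ball
  have hsU : s ∈ U := ⟨hs, by simp⟩
  have : DifferentiableOn ℂ D U := by
    apply differentiableOn_tsum_of_summable_norm (summable_32.mul_left (Real.sqrt (‖s‖ + 1))) _ hU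
    · intro n w hw
      refine (D_term_bound hw.1 n).trans ?_
      have : ‖w‖ < ‖s‖ + 1 := by simpa using hw.2
      gcongr
    · intro n w hw
      have hp := two_mul_re_pos hw.1 n
      have hne : (2 * ((n:ℂ) + 1) + w) ≠ 0 := fun h => by rw [h] at hp; simp at hp
      apply DifferentiableAt.differentiableWithinAt
      fun_prop (disch := assumption)
  exact ((this s hsU).differentiableAt (hU.mem_nhds hsU)).differentiableWithinAt

lemma D_ofReal {x : ℝ} (hx : 0 < x) :
    digamma ((x:ℂ) / 2 + 1) / 2 = -(Real.eulerMascheroniConstant : ℂ) / 2 + D x := by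
  have h := (dG_hasSum (half_pos hx))
  have h2 := ((Complex.hasSum_ofReal.mpr h).mul_left (1/2 : ℂ)).tsum_eq
  have e : D x = ∑' n : ℕ, (1/2:ℂ) * ((1 / ((n:ℝ) + 1) - 1 / (n + 1 + x / 2) : ℝ) : ℂ) := by
    unfold D
    congr 1; ext n
    have a1 : ((n:ℂ) + 1) ≠ 0 := Nat.cast_add_one_ne_zero n
    have a2 : ((n:ℂ) + 1 + x / 2) ≠ 0 := by
      have : ((n:ℝ) + 1 + x / 2) ≠ 0 := by positivity
      exact_mod_cast this
    have a3 : (2 * ((n:ℂ) + 1) + x) ≠ 0 := by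
      have : (2 * ((n:ℝ) + 1) + x) ≠ 0 := by positivity
      exact_mod_cast this
    push_cast
    have a4 : (2 * ((n:ℂ) + 1) + x) = 2 * ((n:ℂ) + 1 + x / 2) := by ring
    rw [a4]; field_simp
  rw [e, h2, dG_one]
  have := digamma_ofReal (y := 1 + x / 2) (by positivity)
  push_cast at this ⊢
  rw [add_comm ((x:ℂ)/2) 1, this]; ring

lemma digamma_eq_D {s : ℂ} (hs : 0 < s.re) :
    digamma (s / 2 + 1) / 2 = -(Real.eulerMascheroniConstant : ℂ) / 2 + D s := by
  have hopen : IsOpen {s : ℂ | 0 < s.re} := isOpen_lt continuous_const Complex.continuous_re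
  have hconn : IsPreconnected {s : ℂ | 0 < s.re} :=
    (convex_halfSpace_re_gt 0).isPreconnected
  have hGd : ∀ w : ℂ, 0 < w.re → DifferentiableAt ℂ Complex.Gamma w := fun w hw =>
    differentiableAt_Gamma _ fun m h => by
      have := congrArg Complex.re h
      simp at this
      linarith [(Nat.cast_nonneg m : (0:ℝ) ≤ m)]
  have hG : DifferentiableOn ℂ digamma {s : ℂ | 0 < s.re} := by
    have h1 : DifferentiableOn ℂ Complex.Gamma {s : ℂ | 0 < s.re} := fun w hw =>
      (hGd w hw).differentiableWithinAt
    have h2 := h1.deriv hopen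
    exact h2.div h1 fun w hw => Complex.Gamma_ne_zero_of_re_pos hw
  have hL : AnalyticOnNhd ℂ (fun s => digamma (s / 2 + 1) / 2) {s : ℂ | 0 < s.re} := by
    apply DifferentiableOn.analyticOnNhd _ hopen
    apply DifferentiableOn.div_const
    apply hG.comp (f := fun s : ℂ => s / 2 + 1) (by fun_prop)
    intro w hw
    have : 0 < w.re := hw
    simp; linarith
  have hR : AnalyticOnNhd ℂ (fun s => -(Real.eulerMascheroniConstant : ℂ) / 2 + D s) {s : ℂ | 0 < s.re} :=
    (D_diffOn.const_add _).analyticOnNhd hopen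
  have hz : (1:ℂ) ∈ {s : ℂ | 0 < s.re} := by simp
  refine hL.eqOn_of_preconnected_of_frequently_eq hR hconn hz ?_ hs
  have ht : Tendsto (fun x : ℝ => (x : ℂ)) (𝓝[>] 1) (𝓝[≠] 1) := by
    apply tendsto_nhdsWithin_iff.mpr ⟨?_, ?_⟩
    · have : Tendsto (fun x : ℝ => (x : ℂ)) (𝓝 1) (𝓝 ((1:ℝ):ℂ)) := Complex.continuous_ofReal.tendsto 1
      simpa using this.mono_left nhdsWithin_le_nhds
    · filter_upwards [self_mem_nhdsWithin] with x hx
      have : (1:ℝ) < x := hx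
      simp only [Set.mem_compl_iff, Set.mem_singleton_iff]
      exact_mod_cast this.ne'
  apply ht.frequently
  apply Eventually.frequently
  filter_upwards [self_mem_nhdsWithin] with x hx
  exact D_ofReal (lt_trans one_pos hx)

lemma D_re_mono {s : ℂ} (hs : 0 < s.re) : (D (s.re : ℂ)).re ≤ (D s).re := by
  unfold D
  rw [Complex.re_tsum (D_summable hs), Complex.re_tsum (D_summable (s := (s.re:ℂ)) (by simpa using hs))]
  apply Summable.tsum_le_tsum
  · intro n
    simp only [Complex.sub_re]
    apply sub_le_sub_left
    have e1 : (1 / (2 * ((n:ℂ) + 1) + s)).re =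
       (2 * ((n:ℝ) + 1) + s.re) / ((2 * ((n:ℝ) + 1) + s.re)^2 + s.im^2) := by
      rw [one_div, Complex.inv_re, Complex.normSq_apply]; simp; ring_nf
    have e2 : (1 / (2 * ((n:ℂ) + 1) + (s.re:ℂ))).re =
       1 / (2 * ((n:ℝ) + 1) + s.re) := by
      have : (1 / (2 * ((n:ℂ) + 1) + (s.re:ℂ))) = ((1 / (2 * ((n:ℝ) + 1) + s.re) : ℝ) : ℂ) := by
        push_cast; rfl
      rw [this, Complex.ofReal_re]
    rw [e1, e2]
    have : 0 < 2 * ((n:ℝ) + 1) + s.re := by positivity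
    rw [div_le_div_iff₀ (by positivity) this]
    nlinarith [sq_nonneg s.im]
  · exact (Complex.hasSum_re (D_summable (s := (s.re:ℂ)) (by simpa using hs)).hasSum).summable
  · exact (Complex.hasSum_re (D_summable hs).hasSum).summable

lemma D_ofReal_re {x : ℝ} (hx : 0 < x) :
    HasSum (fun n : ℕ => 1 / (2 * ((n:ℝ) + 1)) - 1 / (2 * ((n:ℝ) + 1) + x)) (D x).re ∧
      (D x).im = 0 := by
  have h := (D_summable (s := (x:ℂ)) (by simpa using hx)).hasSum
  have e : ∀ n : ℕ, (1 / (2 * ((n:ℂ) + 1)) - 1 / (2 * ((n:ℂ) + 1) + (x:ℂ))) =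
    ((1 / (2 * ((n:ℝ) + 1)) - 1 / (2 * ((n:ℝ) + 1) + x) : ℝ) : ℂ) := fun n => by push_cast; rfl
  constructor
  · have := Complex.hasSum_re h
    simp_rw [e, Complex.ofReal_re] at this
    simp_rw [D, e]; exact this
  · have := Complex.hasSum_im h
    simp_rw [e, Complex.ofReal_im] at this
    have h0 := this.unique hasSum_zero
    simp_rw [D, e]; exact h0

lemma D_tendsto : Tendsto (fun x : ℝ => (D x).re) atTop atTop := by
  rw [tendsto_atTop]
  intro b
  have hdiv : Tendsto (fun N : ℕ => ∑ i ∈ Finset.range N, (1 / ((i:ℝ) + 1))) atTop atTop :=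
    Real.tendsto_sum_range_one_div_nat_succ_atTop
  obtain ⟨N, hN⟩ := (hdiv.eventually_ge_atTop (2 * (b + 1))).exists
  have hlim : Tendsto (fun x : ℝ => ∑ i ∈ Finset.range N,
      (1 / (2 * ((i:ℝ) + 1)) - 1 / (2 * ((i:ℝ) + 1) + x))) atTop
      (𝓝 (∑ i ∈ Finset.range N, (1 / (2 * ((i:ℝ) + 1)) - 0))) := by
    apply tendsto_finsetSum
    intro i _
    apply Tendsto.sub tendsto_const_nhds
    simp_rw [one_div]
    exact tendsto_inv_atTop_zero.comp (tendsto_atTop_add_const_left _ _ tendsto_id)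
  have hgt : b < ∑ i ∈ Finset.range N, (1 / (2 * ((i:ℝ) + 1)) - 0) := by
    have : ∑ i ∈ Finset.range N, (1 / (2 * ((i:ℝ) + 1)) - 0)
       = (1/2) * ∑ i ∈ Finset.range N, (1 / ((i:ℝ) + 1)) := by
      rw [Finset.mul_sum]; apply Finset.sum_congr rfl; intro i _
      have : (i:ℝ) + 1 ≠ 0 := by positivity
      field_simp; simp
    rw [this]; linarith
  filter_upwards [hlim.eventually (lt_mem_nhds hgt), eventually_gt_atTop 0] with x hx hx0
  refine hx.le.trans ?_
  refine sum_le_hasSum _ (fun i _ => ?_) (D_ofReal_re hx0).1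
  rw [sub_nonneg]
  apply one_div_le_one_div_of_le (by positivity) (by linarith)

end PsiRH

namespace PsiRH
open Complex Topology

noncomputable def Xi (s : ℂ) : ℂ := s * (s - 1) * completedRiemannZeta₀ s + 1

lemma Xi_diff : Differentiable ℂ Xi := by
  unfold Xi
  exact ((differentiable_id.mul (differentiable_id.sub_const 1)).mul
    differentiable_completedZeta₀).add_const 1

lemma Xi_one_sub (s : ℂ) : Xi (1 - s) = Xi s := by
  unfold Xi
  rw [completedRiemannZeta₀_one_sub]; ring

lemma Xi_one : Xi 1 = 1 := by simp [Xi]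

lemma Xi_eq {s : ℂ} (hs : 0 < s.re) (h1 : s ≠ 1) :
    Xi s = 2 * (s - 1) * (Real.pi : ℂ) ^ (-s / 2) * Gamma (s / 2 + 1) * riemannZeta s := by
  have hG : Gamma (s / 2 + 1) ≠ 0 := by
    apply Gamma_ne_zero_of_re_pos
    simp; positivity
  have hpi : (Real.pi : ℂ) ^ (-s / 2) ≠ 0 := by
    simp [cpow_eq_zero_iff, Real.pi_ne_zero]
  have h1' : (1 - s) ≠ 0 := sub_ne_zero.mpr (Ne.symm h1)
  rw [riemannZeta_eq_mul_completedRiemannZeta₀, Xi]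
  generalize Gamma (s / 2 + 1) = G at *
  generalize (Real.pi : ℂ) ^ (-s / 2) = p at *
  field_simp
  ring

lemma Xi_conj {s : ℂ} (hs : 0 < s.re) : Xi (starRingEnd ℂ s) = starRingEnd ℂ (Xi s) := by
  by_cases h1 : s = 1
  · subst h1; simp [Xi_one]
  have h1' : starRingEnd ℂ s ≠ 1 := by
    intro h; apply h1
    have := congrArg (starRingEnd ℂ) h
    simpa using this
  rw [Xi_eq (by simpa using hs) h1', Xi_eq hs h1, riemannZeta_conj]
  simp only [map_mul, map_sub, map_one, map_ofNat]
  congr 2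
  · congr 1
    have := cpow_conj (Real.pi : ℂ) (-s/2) (by
      rw [Complex.arg_ofReal_of_nonneg Real.pi_pos.le]; exact Real.pi_pos.ne)
    simp only [map_div₀, map_neg, map_ofNat, conj_ofReal] at this
    exact this
  · rw [← Gamma_conj]; simp only [map_add, map_div₀, map_one, map_ofNat]

lemma Xi_ne_zero (hRH : RiemannHypothesis) {s : ℂ} (hs : 1/2 < s.re) : Xi s ≠ 0 := by
  by_cases h1 : s = 1
  · subst h1; simp [Xi_one]
  have hs0 : 0 < s.re := by linarith
  have hG : Gamma (s / 2 + 1) ≠ 0 := by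
    apply Gamma_ne_zero_of_re_pos
    simp; positivity
  have hpi : (Real.pi : ℂ) ^ (-s / 2) ≠ 0 := by
    simp [cpow_eq_zero_iff, Real.pi_ne_zero]
  have hz : riemannZeta s ≠ 0 := by
    intro h
    have := hRH s h (by
      rintro ⟨n, hn⟩
      have : s.re = -2 * (n+1) := by rw [hn]; simp
      have : (0:ℝ) ≤ n := Nat.cast_nonneg n
      linarith) h1
    linarith
  rw [Xi_eq hs0 h1]
  have : s - 1 ≠ 0 := sub_ne_zero.mpr h1
  exact mul_ne_zero (mul_ne_zero (mul_ne_zero (mul_ne_zero two_ne_zero this) hpi) hG) hz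

lemma Lam_bound (c : ℝ) : ∃ K : ℝ, 0 ≤ K ∧ ∀ s : ℂ, 0 ≤ s.re → s.re ≤ c →
    ‖completedRiemannZeta₀ s‖ ≤ K := by
  set P := HurwitzZeta.hurwitzEvenFEPair 0 with hP
  have hM : ∀ s : ℂ, MellinConvergent P.f_modif s := fun s =>
    (P.isStrongFEPair_toStrongFEPair.hasMellin s).1
  have hI : ∀ x : ℝ, IntegrableOn (fun t : ℝ => t ^ (x - 1) * ‖P.f_modif t‖) (Set.Ioi 0) := by
    intro x
    have := (hM (x:ℂ)).norm
    refine IntegrableOn.congr_fun this (fun t ht => ?_) measurableSet_Ioi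
    have ht : 0 < t := ht
    simp only [norm_smul]
    rw [Complex.norm_cpow_eq_rpow_re_of_pos ht]; simp
  refine ⟨(∫ t in Set.Ioi (0:ℝ), (t ^ ((0:ℝ) - 1) * ‖P.f_modif t‖ + t ^ (c/2 - 1) * ‖P.f_modif t‖)) / 2, ?_, ?_⟩
  · apply div_nonneg _ (by norm_num)
    apply setIntegral_nonneg measurableSet_Ioi
    intro t ht
    have ht : 0 < t := ht
    positivity
  · intro s h0 hc
    have : completedRiemannZeta₀ s = mellin P.f_modif (s/2) / 2 := rfl
    rw [this, norm_div, mellin]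
    simp only [Complex.norm_ofNat]
    gcongr
    apply norm_integral_le_of_norm_le ((hI 0).add (hI (c/2)))
    refine (ae_restrict_iff' measurableSet_Ioi).mpr (Eventually.of_forall fun t ht => ?_)
    have ht : 0 < t := ht
    rw [norm_smul, Complex.norm_cpow_eq_rpow_re_of_pos ht, Pi.add_apply, ← add_mul]
    gcongr
    have e : (s/2 - 1).re = s.re/2 - 1 := by simp
    rw [e]
    rcases le_total t 1 with h | h
    · have := Real.rpow_le_rpow_of_exponent_ge ht h (show (0:ℝ) - 1 ≤ s.re/2 - 1 by linarith)
      have := Real.rpow_nonneg ht.le (c/2-1)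
      linarith
    · have := Real.rpow_le_rpow_of_exponent_le h (show s.re/2 - 1 ≤ c/2 - 1 by linarith)
      exact this.trans (le_add_of_nonneg_left (Real.rpow_nonneg ht.le _))

lemma Xi_bound (c : ℝ) : ∃ K : ℝ, 1 ≤ K ∧ ∀ s : ℂ, 0 ≤ s.re → s.re ≤ c →
    ‖Xi s‖ ≤ K * (1 + |s.im|) ^ 2 := by
  obtain ⟨K, hK, h⟩ := Lam_bound c
  refine ⟨(1 + |c|) * (1 + |c| + 1) * K + 1, ?_, ?_⟩
  · have : 0 ≤ (1 + |c|) * (1 + |c| + 1) * K := by positivity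
    linarith
  intro s h0 hc
  have h1 : ‖s‖ ≤ (1 + |c|) * (1 + |s.im|) := by
    have := Complex.norm_le_abs_re_add_abs_im s
    rw [abs_of_nonneg h0] at this
    nlinarith [le_abs_self c, abs_nonneg c, abs_nonneg s.im, mul_nonneg (abs_nonneg c) (abs_nonneg s.im)]
  have h2 : ‖s - 1‖ ≤ (1 + |c| + 1) * (1 + |s.im|) := by
    have := norm_sub_le s 1
    rw [norm_one] at this
    nlinarith [abs_nonneg s.im]
  unfold Xi
  calc ‖s * (s - 1) * completedRiemannZeta₀ s + 1‖
      ≤ ‖s‖ * ‖s - 1‖ * ‖completedRiemannZeta₀ s‖ + 1 := by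
        refine (norm_add_le _ _).trans ?_
        rw [norm_mul, norm_mul, norm_one]
    _ ≤ ((1 + |c|) * (1 + |s.im|)) * ((1 + |c| + 1) * (1 + |s.im|)) * K + 1 * (1 + |s.im|)^2 := by
        gcongr
        · exact h s h0 hc
        · nlinarith [abs_nonneg s.im]
    _ = _ := by ring

end PsiRH

namespace PsiRH
open Complex Topology

noncomputable def F (s : ℂ) : ℂ := logDeriv Xi s

lemma F_diffAt (hRH : RiemannHypothesis) {s : ℂ} (hs : 1/2 < s.re) : DifferentiableAt ℂ F s := by
  have : F = fun s => deriv Xi s / Xi s := by ext s; simp [F, logDeriv_apply]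
  rw [this]
  exact (Xi_diff.analyticAt s).deriv.differentiableAt.div (Xi_diff s) (Xi_ne_zero hRH hs)

lemma deriv_Xi (hRH : RiemannHypothesis) {s : ℂ} (hs : 1/2 < s.re) : HasDerivAt Xi (Xi s * F s) s := by
  have h := (Xi_diff s).hasDerivAt
  have e : Xi s * F s = deriv Xi s := by
    rw [F, logDeriv_apply]; field_simp [Xi_ne_zero hRH hs]
  rwa [e]

lemma F_eq {s : ℂ} (hs : 1/2 < s.re) (h1 : s ≠ 1) (hz : riemannZeta s ≠ 0) :
    F s = 1/(s-1) - (Real.log Real.pi : ℂ)/2 - (Real.eulerMascheroniConstant : ℂ)/2 + D s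
      + deriv riemannZeta s / riemannZeta s := by
  have hs0 : 0 < s.re := by linarith
  have hG : Gamma (s / 2 + 1) ≠ 0 := by
    apply Gamma_ne_zero_of_re_pos
    simp; positivity
  have hpi0 : (Real.pi:ℂ) ≠ 0 := by simp [Real.pi_ne_zero]
  have hpi : (Real.pi : ℂ) ^ (-s / 2) ≠ 0 := by
    simp [cpow_eq_zero_iff, Real.pi_ne_zero]
  have hsub : s - 1 ≠ 0 := sub_ne_zero.mpr h1
  have hGd : DifferentiableAt ℂ Gamma (s/2+1) := by
    apply differentiableAt_Gamma
    intro m hm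
    have := congrArg Complex.re hm
    simp at this
    have : (0:ℝ) ≤ m := Nat.cast_nonneg m
    linarith
  have hev : Xi =ᶠ[𝓝 s] fun s => 2 * (s - 1) * (Real.pi : ℂ) ^ (-s / 2) * Gamma (s / 2 + 1) * riemannZeta s := by
    have o1 : ∀ᶠ z in 𝓝 s, 0 < z.re := continuous_re.continuousAt.eventually (lt_mem_nhds hs0)
    have o2 : ∀ᶠ z in 𝓝 s, z ≠ 1 := eventually_ne_nhds h1
    filter_upwards [o1, o2] with z h1 h2 using Xi_eq h1 h2
  have d1 : HasDerivAt (fun s : ℂ => 2 * (s-1)) 2 s := by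
    simpa using ((hasDerivAt_id s).sub_const 1).const_mul 2
  have d2 : HasDerivAt (fun s : ℂ => (Real.pi : ℂ) ^ (-s / 2)) ((Real.pi : ℂ) ^ (-s / 2) * Complex.log Real.pi * (-1/2)) s := by
    have : HasDerivAt (fun s : ℂ => -s/2) (-1/2) s := ((hasDerivAt_id s).neg).div_const 2
    exact this.const_cpow (Or.inl hpi0)
  have d3 : HasDerivAt (fun s : ℂ => Gamma (s/2+1)) (deriv Gamma (s/2+1) * (1/2)) s := by
    have : HasDerivAt (fun s : ℂ => s/2+1) (1/2) s := ((hasDerivAt_id s).div_const 2).add_const 1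
    exact hGd.hasDerivAt.comp s this
  have d4 := (differentiableAt_riemannZeta h1).hasDerivAt
  rw [F, (logDeriv_congr_nhds hev).eq_of_nhds, logDeriv_apply, (((d1.fun_mul d2).fun_mul d3).fun_mul d4).deriv]
  have hdg : deriv Gamma (s/2+1) = Gamma (s/2+1) * digamma (s/2+1) := by
    rw [digamma_def, logDeriv_apply, mul_div_assoc', mul_div_cancel_left₀ _ hG]
  have hdD : digamma (s/2+1) = 2 * (-(Real.eulerMascheroniConstant : ℂ)/2 + D s) := by
    rw [← digamma_eq_D hs0]; ring
  rw [hdg, hdD, ← Complex.ofReal_log Real.pi_pos.le]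
  generalize Gamma (s/2+1) = G at *
  generalize (Real.pi:ℂ)^(-s/2) = p at *
  generalize D s = d
  generalize deriv riemannZeta s = z'
  generalize riemannZeta s = z at *
  field_simp
  ring

lemma zeta_ne {s : ℂ} (hs : 1 < s.re) : s ≠ 1 ∧ riemannZeta s ≠ 0 := by
  refine ⟨?_, riemannZeta_ne_zero_of_one_lt_re hs⟩
  rintro rfl; simp at hs

lemma logDeriv_zeta_bound : ∃ B : ℝ, 0 ≤ B ∧ ∀ s : ℂ, 2 ≤ s.re →
    ‖deriv riemannZeta s / riemannZeta s‖ ≤ B := by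
  have hS := ArithmeticFunction.LSeriesSummable_vonMangoldt (s := 2) (by simp)
  refine ⟨∑' n, ‖LSeries.term (fun n => (ArithmeticFunction.vonMangoldt n : ℂ)) 2 n‖, tsum_nonneg fun _ => norm_nonneg _, ?_⟩
  intro s hs
  have h := ArithmeticFunction.LSeries_vonMangoldt_eq_deriv_riemannZeta_div (s := s) (by linarith)
  rw [neg_div] at h
  rw [← norm_neg, ← h, LSeries]
  have hS' := ArithmeticFunction.LSeriesSummable_vonMangoldt (s := s) (by linarith)
  refine (norm_tsum_le_tsum_norm hS'.norm).trans ?_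
  apply hS'.norm.tsum_le_tsum _ hS.norm
  intro n
  exact LSeries.norm_term_le_of_re_le_re _ (by simpa using hs) n

lemma F_bound : ∃ A : ℝ, 0 ≤ A ∧ ∀ s : ℂ, 2 ≤ s.re → ‖F s‖ ≤ A * (1 + Real.sqrt ‖s‖) := by
  obtain ⟨B, hB, hD⟩ := D_bound
  obtain ⟨B', hB', hZ⟩ := logDeriv_zeta_bound
  refine ⟨1 + |Real.log Real.pi|/2 + |Real.eulerMascheroniConstant|/2 + B + B', by positivity, ?_⟩
  intro s hs
  obtain ⟨h1, h2⟩ := zeta_ne (show 1 < s.re by linarith)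
  rw [F_eq (by linarith) h1 h2]
  have e1 : ‖1/(s-1)‖ ≤ 1 := by
    rw [norm_div, norm_one]
    apply div_le_one_of_le₀ _ (norm_nonneg _)
    have := Complex.re_le_norm (s-1)
    simp at this
    linarith
  have e2 : ‖(Real.log Real.pi : ℂ)/2‖ = |Real.log Real.pi|/2 := by
    rw [norm_div, Complex.norm_real]; simp
  have e3 : ‖(Real.eulerMascheroniConstant : ℂ)/2‖ = |Real.eulerMascheroniConstant|/2 := by
    rw [norm_div, Complex.norm_real]; simp
  have e4 := hD s (by linarith)
  have e5 := hZ s hs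
  have n1 := norm_add_le (1/(s-1) - (Real.log Real.pi : ℂ)/2 - (Real.eulerMascheroniConstant : ℂ)/2 + D s) (deriv riemannZeta s / riemannZeta s)
  have n2 := norm_add_le (1/(s-1) - (Real.log Real.pi : ℂ)/2 - (Real.eulerMascheroniConstant : ℂ)/2) (D s)
  have n3 := norm_sub_le (1/(s-1) - (Real.log Real.pi : ℂ)/2) (Real.eulerMascheroniConstant/2 : ℂ)
  have n4 := norm_sub_le (1/(s-1)) ((Real.log Real.pi : ℂ)/2)
  have hq := Real.sqrt_nonneg ‖s‖
  nlinarith [mul_nonneg hB' hq, mul_nonneg (abs_nonneg (Real.log Real.pi)) hq, mul_nonneg (abs_nonneg Real.eulerMascheroniConstant) hq]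

lemma F_re_nonneg_large : ∃ σ : ℝ, 2 ≤ σ ∧ ∀ s : ℂ, σ ≤ s.re → 0 ≤ (F s).re := by
  obtain ⟨B', hB', hZ⟩ := logDeriv_zeta_bound
  obtain ⟨σ, hσ⟩ := (D_tendsto.eventually_ge_atTop (Real.log Real.pi/2 + Real.eulerMascheroniConstant/2 + B')).exists_forall_of_atTop
  refine ⟨max 2 σ, le_max_left _ _, ?_⟩
  intro s hs
  have hs2 : 2 ≤ s.re := (le_max_left _ _).trans hs
  have hsσ : σ ≤ s.re := (le_max_right _ _).trans hs
  obtain ⟨h1, h2⟩ := zeta_ne (show 1 < s.re by linarith)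
  rw [F_eq (by linarith) h1 h2]
  have e1 : 0 ≤ (1/(s-1)).re := by
    rw [one_div, Complex.inv_re]
    apply div_nonneg _ (normSq_nonneg _)
    simp; linarith
  have e2 := hσ _ hsσ
  have e3 := D_re_mono (s := s) (by linarith)
  have e4 := (Complex.abs_re_le_norm _).trans (hZ s hs2)
  have e5 := neg_le_of_abs_le e4
  have r1 : ((Real.log Real.pi : ℂ)/2).re = Real.log Real.pi/2 := by
    rw [← Complex.ofReal_ofNat, ← Complex.ofReal_div, Complex.ofReal_re]
  have r2 : ((Real.eulerMascheroniConstant : ℂ)/2).re = Real.eulerMascheroniConstant/2 := by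
    rw [← Complex.ofReal_ofNat, ← Complex.ofReal_div, Complex.ofReal_re]
  simp only [Complex.add_re, Complex.sub_re, r1, r2]
  linarith

lemma F_one (hRH : RiemannHypothesis) : F 1 = ((1 + Real.eulerMascheroniConstant/2 - Real.log Real.pi/2 - Real.log 2 : ℝ) : ℂ) := by
  have hD1 : D 1 = 1 - (Real.log 2 : ℂ) := by
    have h := digamma_eq_D (s := 1) (by simp)
    rw [digamma_apply_add_one _ (by
      intro m hm
      have := congrArg Complex.re hm
      simp at this
      have : (0:ℝ) ≤ m := Nat.cast_nonneg m
      linarith), digamma_one_half] at h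
    rw [Complex.ofReal_log (by norm_num)]
    push_cast
    linear_combination -h
  have hcont : Tendsto F (𝓝[≠] 1) (𝓝 (F 1)) :=
    (F_diffAt hRH (by norm_num)).continuousAt.tendsto.mono_left nhdsWithin_le_nhds
  have hDc : Tendsto D (𝓝[≠] 1) (𝓝 (D 1)) := by
    have : DifferentiableAt ℂ D 1 := D_diffOn.differentiableAt
      ((isOpen_lt continuous_const continuous_re).mem_nhds (by simp))
    exact this.continuousAt.tendsto.mono_left nhdsWithin_le_nhds
  have hz : Tendsto (fun s : ℂ => deriv riemannZeta s / riemannZeta s + (s-1)⁻¹ - Real.eulerMascheroniConstant) (𝓝[≠] 1) (𝓝 0) :=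
    (Asymptotics.isLittleO_one_iff ℂ).mp log_deriv_riemannZeta_add_inv_sub_sub_isLittleO
  have hlim := ((hz.add hDc).add_const ((Real.eulerMascheroniConstant:ℂ)/2 - (Real.log Real.pi : ℂ)/2))
  have heq : F =ᶠ[𝓝[≠] 1] fun s => deriv riemannZeta s / riemannZeta s + (s-1)⁻¹ - Real.eulerMascheroniConstant + D s + ((Real.eulerMascheroniConstant:ℂ)/2 - (Real.log Real.pi : ℂ)/2) := by
    have o1 : ∀ᶠ z in 𝓝[≠] (1:ℂ), 1/2 < z.re :=
      (continuous_re.continuousAt.eventually (lt_mem_nhds (by norm_num))).filter_mono nhdsWithin_le_nhds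
    filter_upwards [o1, self_mem_nhdsWithin] with s h1 h2
    have hz : riemannZeta s ≠ 0 := by
      intro h
      apply Xi_ne_zero hRH h1
      rw [Xi_eq (by linarith) h2, h, mul_zero]
    rw [F_eq h1 h2 hz]; ring
  have := tendsto_nhds_unique hcont (hlim.congr' heq.symm)
  rw [this, hD1]; push_cast; ring

lemma F_two_le : (F 2).re ≤ 3/2 - Real.log Real.pi/2 - Real.eulerMascheroniConstant/2 := by
  have hD2 : D 2 = 1/2 := by
    have h := digamma_eq_D (s := 2) (by simp)
    rw [show (2:ℂ)/2+1 = 1 + 1 by norm_num, digamma_apply_add_one _ (by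
      intro m hm
      have := congrArg Complex.re hm
      simp at this
      have : (0:ℝ) ≤ m := Nat.cast_nonneg m
      linarith), digamma_one] at h
    linear_combination -h
  have h1 := (zeta_ne (s := 2) (by simp))
  have h := ArithmeticFunction.LSeries_vonMangoldt_eq_deriv_riemannZeta_div (s := 2) (by simp)
  have hS := ArithmeticFunction.LSeriesSummable_vonMangoldt (s := 2) (by simp)
  rw [F_eq (by norm_num) h1.1 h1.2, hD2]
  have hpos : 0 ≤ (-(deriv riemannZeta 2 / riemannZeta 2)).re := by
    rw [← neg_div, ← h, LSeries, Complex.re_tsum hS]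
    apply tsum_nonneg
    intro n
    rw [LSeries.term_def]
    split_ifs
    · simp
    · have : (ArithmeticFunction.vonMangoldt n : ℂ) / (n:ℂ)^(2:ℂ) = ((ArithmeticFunction.vonMangoldt n / (n:ℝ)^2 : ℝ) : ℂ) := by
        push_cast
        norm_cast
      rw [this, Complex.ofReal_re]
      exact div_nonneg ArithmeticFunction.vonMangoldt_nonneg (by positivity)
  have r1 : ((Real.log Real.pi : ℂ)/2).re = Real.log Real.pi/2 := by
    rw [← Complex.ofReal_ofNat, ← Complex.ofReal_div, Complex.ofReal_re]
  have r2 : ((Real.eulerMascheroniConstant : ℂ)/2).re = Real.eulerMascheroniConstant/2 := by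
    rw [← Complex.ofReal_ofNat, ← Complex.ofReal_div, Complex.ofReal_re]
  have r3 : ((1:ℂ)/(2-1)).re = 1 := by norm_num
  have r4 : ((1:ℂ)/2).re = 1/2 := by norm_num
  rw [Complex.neg_re] at hpos
  simp only [Complex.add_re, Complex.sub_re, r1, r2, r3, r4]
  linarith

end PsiRH

namespace PsiRH
open Complex Topology

lemma log_norm_deriv {f : ℝ → ℂ} {x : ℝ} {q : ℂ} (hf : HasDerivAt f (f x * q) x) (hne : f x ≠ 0) :
    HasDerivAt (fun y => Real.log (‖f y‖^2)) (2 * q.re) x := by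
  have h1 := hf.norm_sq
  have hn : ‖f x‖^2 ≠ 0 := by positivity
  have h2 := h1.log hn
  convert h2 using 1
  have : inner ℝ (f x) (f x * q) = ‖f x‖^2 * q.re := by
    rw [Complex.inner, ← Complex.normSq_eq_norm_sq, ← Complex.re_ofReal_mul, Complex.normSq_eq_conj_mul_self]
    congr 1; ring
  rw [this]; field_simp

noncomputable def L (s : ℂ) : ℝ := Real.log (‖Xi s‖^2)

lemma L_deriv (hRH : RiemannHypothesis) (s₀ d : ℂ) (y : ℝ) (hs : 1/2 < (s₀ + y * d).re) :
    HasDerivAt (fun y : ℝ => L (s₀ + y * d)) (2 * (d * F (s₀ + y * d)).re) y := by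
  have h1 : HasDerivAt (fun y : ℝ => s₀ + (y:ℂ) * d) d y := by
    simpa using ((Complex.ofRealCLM.hasDerivAt (x := y)).mul_const d).const_add s₀
  have h2 : HasDerivAt (fun y : ℝ => Xi (s₀ + y * d)) (Xi (s₀ + y * d) * (d * F (s₀ + y * d))) y := by
    have := (deriv_Xi hRH hs).comp y h1
    rw [mul_assoc, mul_comm (F _) d] at this
    exact this
  exact log_norm_deriv h2 (Xi_ne_zero hRH hs)

lemma L_vert (hRH : RiemannHypothesis) (c : ℝ) (hc : 2 ≤ c) : ∃ N : ℝ, 0 ≤ N ∧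
    ∀ t : ℝ, -N * (1 + |t|)^2 ≤ L (c + t * I) := by
  obtain ⟨A, hA, hF⟩ := F_bound
  refine ⟨2 * A * (c + 3) + |L c|, by positivity, ?_⟩
  intro t
  have hre : ∀ y : ℝ, ((c:ℂ) + y * I).re = c := by intro y; simp
  have hmv := Convex.norm_image_sub_le_of_norm_hasDerivWithin_le (f := fun y : ℝ => L (c + y * I))
    (f' := fun y : ℝ => 2 * (I * F (c + y * I)).re) (s := Set.Icc (-|t|) |t|) (x := 0) (y := t)
    (C := 2 * A * (c + 3) * (1 + |t|))
    (fun y _ => (L_deriv hRH c I y (by rw [hre]; linarith)).hasDerivWithinAt)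
    (by
      intro y hy
      have hy' : |y| ≤ |t| := abs_le.mpr hy
      have h1 := hF (c + y * I) (by rw [hre]; exact hc)
      have h2 : ‖(c:ℂ) + y * I‖ ≤ c + |t| := by
        refine (norm_add_le _ _).trans ?_
        simp [abs_of_nonneg (show 0 ≤ c by linarith)]
        exact hy'
      have h3 : Real.sqrt ‖(c:ℂ) + y * I‖ ≤ 1 + (c + |t|) := by
        rw [Real.sqrt_le_left (by positivity)]
        nlinarith [abs_nonneg t, norm_nonneg ((c:ℂ) + y * I)]
      have h4 := Complex.abs_re_le_norm (I * F (c + y * I))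
      rw [norm_mul, norm_I, one_mul] at h4
      rw [Real.norm_eq_abs, abs_mul, abs_two]
      have h5 : A * (1 + Real.sqrt ‖(c:ℂ) + y * I‖) ≤ A * (1 + (1 + (c + |t|))) := by gcongr
      have h6 : A * (1 + (1 + (c + |t|))) ≤ A * ((c+3) * (1 + |t|)) := by
        gcongr
        nlinarith [abs_nonneg t]
      linarith)
    (convex_Icc _ _) (by simp) (by simp [neg_abs_le, le_abs_self])
  simp only [ofReal_zero, zero_mul, add_zero, sub_zero, Real.norm_eq_abs] at hmv
  have h1 := neg_le_of_abs_le hmv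
  have h2 := neg_abs_le (L c)
  have h3 : 2 * A * (c + 3) * (1 + |t|) * |t| ≤ 2 * A * (c+3) * (1+|t|)^2 := by
    rw [pow_two, ← mul_assoc]
    gcongr; linarith
  have h4 : |L c| * 1 ≤ |L c| * (1 + |t|)^2 := by
    gcongr
    nlinarith [abs_nonneg t]
  nlinarith

lemma L_lower (hRH : RiemannHypothesis) (c h : ℝ) (hc : 2 ≤ c) (hh : 0 < h) : ∃ C : ℝ, 0 ≤ C ∧
    ∀ s : ℂ, 1/2 + h ≤ s.re → s.re ≤ c → -C * (1 + |s.im|)^2 ≤ L s := by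
  obtain ⟨N, hN, hv⟩ := L_vert hRH c hc
  obtain ⟨K, hK, hX⟩ := Xi_bound (2 * c)
  set R := c - 1/2 with hR
  have hRpos : 0 < R := by rw [hR]; linarith
  refine ⟨N + 2 * (2 * (K * (1 + R)^2 + N) * R / h), by positivity, ?_⟩
  intro s hs1 hs2
  set t := s.im with ht
  set z₀ : ℂ := c + t * I with hz₀
  have hball : ∀ z ∈ Metric.ball z₀ R, 1/2 < z.re ∧ z.re ≤ 2 * c ∧ |z.im| ≤ |t| + R := by
    intro z hz
    rw [Metric.mem_ball, dist_eq_norm] at hz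
    have h1 := (Complex.abs_re_le_norm (z - z₀)).trans_lt hz
    have h2 := (Complex.abs_im_le_norm (z - z₀)).trans_lt hz
    simp [hz₀] at h1 h2
    rw [abs_lt] at h1
    refine ⟨by linarith [h1.1], by linarith [h1.2], ?_⟩
    have := abs_add_le (z.im - t) t
    rw [sub_add_cancel] at this
    linarith
  have hFd : DifferentiableOn ℂ F (Metric.ball z₀ R) := fun z hz =>
    (F_diffAt hRH (hball z hz).1).differentiableWithinAt
  obtain ⟨g, hg⟩ := hFd.isExactOn_ball
  have hzz : z₀ ∈ Metric.ball z₀ R := Metric.mem_ball_self hRpos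
  have hconst : ∀ z ∈ Metric.ball z₀ R, Xi z * cexp (-(g z)) = Xi z₀ * cexp (-(g z₀)) := by
    intro z hz
    have hd : ∀ w ∈ Metric.ball z₀ R, HasDerivAt (fun z => Xi z * cexp (-(g z))) 0 w := by
      intro w hw
      have h1 := (deriv_Xi hRH (hball w hw).1).fun_mul ((hg w hw).neg.cexp)
      have e : Xi w * F w * cexp ((-g) w) + Xi w * (cexp ((-g) w) * -F w) = 0 := by ring
      rw [e] at h1
      exact h1
    exact Metric.isOpen_ball.is_const_of_deriv_eq_zero (convex_ball z₀ R).isPreconnected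
      (fun w hw => (hd w hw).differentiableAt.differentiableWithinAt)
      (fun w hw => (hd w hw).deriv) hz hzz
  have hL : ∀ z ∈ Metric.ball z₀ R, L z = L z₀ + 2 * (g z - g z₀).re := by
    intro z hz
    have h1 := hconst z hz
    have hne0 : ‖Xi z₀‖ ≠ 0 := norm_ne_zero_iff.mpr (Xi_ne_zero hRH (hball _ hzz).1)
    have h2 : Xi z = Xi z₀ * cexp (g z - g z₀) := by
      rw [Complex.exp_sub]
      rw [Complex.exp_neg, Complex.exp_neg] at h1
      have e1 := Complex.exp_ne_zero (g z)
      have e2 := Complex.exp_ne_zero (g z₀)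
      field_simp at h1 ⊢
      linear_combination h1
    unfold L
    rw [h2, norm_mul, Complex.norm_exp, mul_pow, Real.log_mul (by positivity) (by positivity), ← Real.exp_nat_mul, Real.log_exp]
    push_cast; ring
  have hv0 := hv t
  set M := (K * (1 + R)^2 + N) * (1 + |t|)^2 with hM
  have hMpos : 0 < M := by positivity
  have hmap : Set.MapsTo (fun z => g (z₀ + z) - g z₀) (Metric.ball 0 R) {z | z.re ≤ M} := by
    intro z hz
    have hz' : z₀ + z ∈ Metric.ball z₀ R := by simpa using hz
    have h1 := hL _ hz'
    obtain ⟨b1, b2, b3⟩ := hball _ hz'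
    have h2 := hX (z₀ + z) (by linarith) b2
    have hpos : 0 < ‖Xi (z₀ + z)‖ := norm_pos_iff.mpr (Xi_ne_zero hRH b1)
    have h3 : L (z₀ + z) ≤ 2 * (K * (1 + R)^2 * (1 + |t|)^2) := by
      unfold L
      rw [Real.log_pow]
      have h4 := Real.log_le_sub_one_of_pos hpos
      have h5 : K * (1 + |(z₀ + z).im|)^2 ≤ K * ((1 + R) * (1 + |t|))^2 := by
        gcongr
        nlinarith [abs_nonneg t]
      rw [mul_pow, ← mul_assoc] at h5
      push_cast
      linarith
    show (g (z₀ + z) - g z₀).re ≤ M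
    have h0 : 0 ≤ N * (1 + |t|)^2 := by positivity
    have h7 : M = K * (1 + R)^2 * (1 + |t|)^2 + N * (1+|t|)^2 := by rw [hM]; ring
    linarith
  have hdiff : DifferentiableOn ℂ (fun z => g (z₀ + z) - g z₀) (Metric.ball 0 R) := by
    intro z hz
    have hz' : z₀ + z ∈ Metric.ball z₀ R := by simpa using hz
    have := (hg _ hz').comp_const_add z₀ z
    exact (this.sub_const _).differentiableAt.differentiableWithinAt
  have hsz : z₀ + ((s.re - c : ℝ) : ℂ) = s := by
    apply Complex.ext <;> simp [hz₀, ht]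
  have hnz : ‖((s.re - c : ℝ) : ℂ)‖ = c - s.re := by
    rw [Complex.norm_real, Real.norm_eq_abs, abs_of_nonpos (by linarith)]; ring
  have hBC := Complex.borelCaratheodory_zero hMpos hdiff hmap hRpos
    (z := ((s.re - c : ℝ) : ℂ)) (by rw [mem_ball_zero_iff, hnz, hR]; linarith) (by simp)
  rw [hsz, hnz] at hBC
  have hb2 : 2 * M * (c - s.re) / (R - (c - s.re)) ≤ 2 * M * R / h := by
    gcongr
    · rw [hR]; linarith
    · rw [hR]; linarith
  have hLs := hL s (by
    rw [← hsz, Metric.mem_ball, dist_eq_norm, add_sub_cancel_left, hnz, hR]; linarith)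
  have h8 := neg_le_of_abs_le ((Complex.abs_re_le_norm _).trans (hBC.trans hb2))
  have h9 : 2 * M * R / h = 2 * (K * (1 + R)^2 + N) * R / h * (1+|t|)^2 := by rw [hM]; ring
  rw [hLs]
  linarith

end PsiRH

namespace PsiRH
open Complex Topology

lemma Xi_le_of_L_le (hRH : RiemannHypothesis) {s w : ℂ} (hs : 1/2 < s.re) (hw : 1/2 < w.re)
    (h : L s ≤ L w) : ‖Xi s‖ ≤ ‖Xi w‖ := by
  have h1 : 0 < ‖Xi s‖ := norm_pos_iff.mpr (Xi_ne_zero hRH hs)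
  have h2 : 0 < ‖Xi w‖ := norm_pos_iff.mpr (Xi_ne_zero hRH hw)
  unfold L at h
  rw [Real.log_le_log_iff (by positivity) (by positivity)] at h
  exact le_of_sq_le_sq h h2.le

lemma L_le_of_Xi_le (hRH : RiemannHypothesis) {s w : ℂ} (hs : 1/2 < s.re)
    (h : ‖Xi s‖ ≤ ‖Xi w‖) : L s ≤ L w := by
  have h1 : 0 < ‖Xi s‖ := norm_pos_iff.mpr (Xi_ne_zero hRH hs)
  unfold L
  gcongr

lemma Xi_mono_large (hRH : RiemannHypothesis) {σ : ℝ} (hσ : 2 ≤ σ)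
    (hF : ∀ s : ℂ, σ ≤ s.re → 0 ≤ (F s).re) {s : ℂ} {h : ℝ} (hh : 0 < h) (hs : σ ≤ s.re - h) :
    ‖Xi (s - h)‖ ≤ ‖Xi (s + h)‖ := by
  apply Xi_le_of_L_le hRH
  · simp; linarith
  · simp; linarith
  have hd : ∀ y ∈ Set.Icc (-h) h, HasDerivAt (fun y : ℝ => L (s + y * 1)) (2 * (1 * F (s + y * 1)).re) y := by
    intro y hy
    apply L_deriv hRH
    simp; linarith [hy.1]
  have hm : MonotoneOn (fun y : ℝ => L (s + y * 1)) (Set.Icc (-h) h) := by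
    apply monotoneOn_of_deriv_nonneg (convex_Icc _ _)
    · exact fun y hy => (hd y hy).continuousAt.continuousWithinAt
    · exact fun y hy => (hd y (interior_subset hy)).differentiableAt.differentiableWithinAt
    · intro y hy
      rw [(hd y (interior_subset hy)).deriv]
      have := hF (s + y * 1) (by
        have := (interior_subset hy).1
        simp; linarith)
      rw [one_mul]; linarith
  have := hm (a := -h) (b := h) ⟨le_refl _, by linarith⟩ ⟨by linarith, le_refl _⟩ (by linarith)
  simpa [sub_eq_add_neg] using this

lemma growth_aux (C c : ℝ) (hC : 0 ≤ C) (hc : 0 < c) (t : ℝ) :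
    C * (1 + |t|)^2 ≤ C * (2 + 4 / c^2) * Real.exp (c * |t|) := by
  have h1 := Real.quadratic_le_exp_of_nonneg (show 0 ≤ c * |t| by positivity)
  rw [mul_assoc]
  gcongr
  have h2 : (1 + |t|)^2 ≤ 2 + 2 * |t|^2 := by nlinarith [sq_nonneg (1 - |t|)]
  have h3 : (2 + 4/c^2) * (1 + c * |t| + (c * |t|)^2/2) ≤ (2 + 4 / c^2) * Real.exp (c * |t|) := by gcongr
  have h4 : 2 + 2 * |t|^2 ≤ (2 + 4/c^2) * (1 + c * |t| + (c * |t|)^2/2) := by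
    have e : (4/c^2) * ((c * |t|)^2/2) = 2 * |t|^2 := by field_simp; ring
    have : 0 ≤ 4/c^2 * (1 + c * |t|) := by positivity
    have : 0 ≤ 2 * (c * |t| + (c * |t|)^2/2) := by positivity
    nlinarith
  linarith

lemma Xi_mono (hRH : RiemannHypothesis) {s : ℂ} {h : ℝ} (hh : 0 < h) (hh2 : h ≤ 1/2)
    (hs : 1/2 ≤ s.re) : ‖Xi (s - h)‖ ≤ ‖Xi (s + h)‖ := by
  obtain ⟨σ, hσ, hF⟩ := F_re_nonneg_large
  set b := max (σ + 1) s.re with hb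
  have hbσ : σ + 1 ≤ b := le_max_left _ _
  obtain ⟨K, hK, hX⟩ := Xi_bound b
  obtain ⟨C, hC, hL⟩ := L_lower hRH (b + 1) h (by linarith) hh
  have hne : ∀ z : ℂ, 1/2 ≤ z.re → Xi (z + h) ≠ 0 := by
    intro z hz
    apply Xi_ne_zero hRH
    simp; linarith
  have hdiff : ∀ z : ℂ, 1/2 ≤ z.re → DifferentiableAt ℂ (fun z => Xi (z - h) / Xi (z + h)) z := by
    intro z hz
    have d1 : DifferentiableAt ℂ (fun z : ℂ => Xi (z - h)) z :=
      (Xi_diff _).comp z (differentiableAt_id.sub_const _)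
    have d2 : DifferentiableAt ℂ (fun z : ℂ => Xi (z + h)) z :=
      (Xi_diff _).comp z (differentiableAt_id.add_const _)
    exact d1.fun_div d2 (hne z hz)
  have hcl : closure (re ⁻¹' Set.Ioo (1/2) b) ⊆ {z : ℂ | 1/2 ≤ z.re} :=
    closure_minimal (fun z hz => le_of_lt hz.1) (isClosed_le continuous_const continuous_re)
  have key := PhragmenLindelof.vertical_strip (f := fun z => Xi (z - h) / Xi (z + h))
    (a := 1/2) (b := b) (C := 1) (z := s)
    ⟨fun z hz => (hdiff z (le_of_lt hz.1)).differentiableWithinAt,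
      fun z hz => (hdiff z (hcl hz)).continuousAt.continuousWithinAt⟩
    (by
      have hbpos : 0 < b - 1/2 := by linarith
      set c := Real.pi / (b - 1/2) / 2 with hcdef
      have hpos : 0 < Real.pi / (b - 1/2) := by have := Real.pi_pos; positivity
      have hc : 0 < c := by positivity
      refine ⟨c, by rw [hcdef]; linarith, (K + C/2) * (2 + 4 / c^2), ?_⟩
      apply Asymptotics.IsBigO.of_bound 1
      rw [eventually_inf_principal]
      refine Eventually.of_forall fun z hz => ?_
      obtain ⟨hz1, hz2⟩ : 1/2 < z.re ∧ z.re < b := hz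
      rw [one_mul, norm_div, Real.norm_eq_abs, abs_of_pos (Real.exp_pos _)]
      have u1 : ‖Xi (z - h)‖ ≤ Real.exp (K * (1 + |z.im|)^2) := by
        have := hX (z - h) (by simp; linarith) (by simp; linarith)
        simp at this
        refine this.trans ?_
        have := Real.add_one_le_exp (K * (1 + |z.im|)^2)
        linarith
      have hp : 0 < ‖Xi (z + h)‖ := norm_pos_iff.mpr (hne z hz1.le)
      have u2 : Real.exp (-(C/2) * (1 + |z.im|)^2) ≤ ‖Xi (z + h)‖ := by
        have := hL (z + h) (by simp; linarith) (by simp; linarith)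
        simp only [add_im, ofReal_im, add_zero, L, Real.log_pow] at this
        push_cast at this
        rw [← Real.exp_log hp]
        gcongr
        linarith
      calc ‖Xi (z - h)‖ / ‖Xi (z + h)‖ ≤ Real.exp (K * (1 + |z.im|)^2) / Real.exp (-(C/2) * (1 + |z.im|)^2) := by gcongr
        _ = Real.exp ((K + C/2) * (1 + |z.im|)^2) := by rw [← Real.exp_sub]; congr 1; ring
        _ ≤ _ := by
          exact Real.exp_le_exp.mpr (growth_aux _ _ (by positivity) hc _))
    (by
      intro z hz
      have hp : 0 < ‖Xi (z + h)‖ := norm_pos_iff.mpr (hne z hz.ge)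
      rw [norm_div, div_le_one hp]
      have e : (1:ℂ) - (z - h) = starRingEnd ℂ (z + h) := by
        apply Complex.ext
        · simp; linarith
        · simp
      rw [← Xi_one_sub, e, Xi_conj (by simp; linarith), Complex.norm_conj])
    (by
      intro z hz
      have hp : 0 < ‖Xi (z + h)‖ := norm_pos_iff.mpr (hne z (by linarith))
      rw [norm_div, div_le_one hp]
      exact Xi_mono_large hRH hσ hF hh (by linarith))
    hs (le_max_right _ _)
  have hp : 0 < ‖Xi (s + h)‖ := norm_pos_iff.mpr (hne s hs)
  rwa [norm_div, div_le_one hp] at key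

lemma F_re_nonneg (hRH : RiemannHypothesis) {s : ℂ} (hs : 1/2 < s.re) : 0 ≤ (F s).re := by
  have d1 := L_deriv hRH s 1 0 (by simpa using hs)
  have d2 := L_deriv hRH s (-1) 0 (by simpa using hs)
  have d := d1.fun_sub d2
  have e : 2 * (1 * F (s + ((0:ℝ):ℂ) * 1)).re - 2 * (-1 * F (s + ((0:ℝ):ℂ) * (-1))).re = 4 * (F s).re := by
    simp; ring
  rw [e] at d
  have hsl := d.tendsto_slope_zero_right
  suffices 0 ≤ 4 * (F s).re by linarith
  apply ge_of_tendsto hsl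
  have hev : ∀ᶠ y : ℝ in 𝓝[>] 0, y < min (1/2) (s.re - 1/2) :=
    nhdsWithin_le_nhds (Iio_mem_nhds (by
      apply lt_min <;> linarith))
  filter_upwards [hev, self_mem_nhdsWithin] with y hy hy0
  have hy0 : 0 < y := hy0
  have hy1 : y < 1/2 := hy.trans_le (min_le_left _ _)
  have hy2 : y < s.re - 1/2 := hy.trans_le (min_le_right _ _)
  have h1 := L_le_of_Xi_le hRH (by simp; linarith) (Xi_mono hRH hy0 hy1.le hs.le)
  simp only [zero_add, ofReal_zero, zero_mul, add_zero, sub_self, sub_zero, mul_one, mul_neg, ← sub_eq_add_neg, smul_eq_mul]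
  have : 0 ≤ y⁻¹ := by positivity
  exact mul_nonneg this (by linarith)

/-- growth of F in half planes to the right of 1/2 -/
lemma F_growth (hRH : RiemannHypothesis) {δ : ℝ} (hδ : 0 < δ) : ∃ C : ℝ, 0 ≤ C ∧ ∀ s : ℂ,
    1/2 + δ ≤ s.re → s.re ≤ 2 → ‖F s‖ ≤ C * (1 + Real.sqrt |s.im|) := by
  obtain ⟨A, hA, hF⟩ := F_bound
  refine ⟨(2 * (3/2) / δ + 3 / δ * (A * 3)), by positivity, ?_⟩
  intro s h1 h2
  set z₀ : ℂ := (2:ℝ) + s.im * I with hz₀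
  have hball : ∀ z ∈ Metric.ball (0:ℂ) (3/2), 1/2 < (z₀ + z).re := by
    intro z hz
    rw [mem_ball_zero_iff] at hz
    have := (Complex.abs_re_le_norm z).trans_lt hz
    rw [abs_lt] at this
    simp [hz₀]; linarith
  have hsz : z₀ + ((s.re - 2 : ℝ) : ℂ) = s := by
    apply Complex.ext <;> simp [hz₀]
  have hnz : ‖((s.re - 2 : ℝ) : ℂ)‖ = 2 - s.re := by
    rw [Complex.norm_real, Real.norm_eq_abs, abs_of_nonpos (by linarith)]; ring
  have hBC := Complex.borelCaratheodory (M := 1) (R := 3/2) (f := fun z => -F (z₀ + z)) one_pos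
    (fun z hz => (((F_diffAt hRH (hball z hz)).comp z (differentiableAt_id.const_add z₀)).neg).differentiableWithinAt)
    (fun z hz => by
      have := F_re_nonneg hRH (hball z hz)
      show (-F (z₀ + z)).re ≤ 1
      rw [neg_re]; linarith) (by norm_num)
    (z := ((s.re - 2 : ℝ) : ℂ)) (by rw [mem_ball_zero_iff, hnz]; linarith)
  rw [hsz, hnz, norm_neg, norm_neg, add_zero] at hBC
  have hFz := hF z₀ (by simp [hz₀])
  have hq := Real.sqrt_nonneg |s.im|
  have hsq : Real.sqrt ‖z₀‖ ≤ 2 + Real.sqrt |s.im| := by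
    rw [Real.sqrt_le_left (by positivity)]
    have : ‖z₀‖ ≤ 2 + |s.im| := by
      refine (norm_add_le _ _).trans ?_
      simp
    have := Real.sq_sqrt (abs_nonneg s.im)
    nlinarith
  have hFz' : ‖F z₀‖ ≤ A * 3 * (1 + Real.sqrt |s.im|) := by
    refine hFz.trans ?_
    rw [mul_assoc]; gcongr; linarith
  have b1 : 2 * 1 * (2 - s.re) / (3/2 - (2 - s.re)) ≤ 2 * (3/2) / δ := by
    rw [mul_one]
    gcongr <;> linarith
  have b2 : ‖F z₀‖ * (3/2 + (2 - s.re)) / (3/2 - (2 - s.re)) ≤ (A * 3 * (1 + Real.sqrt |s.im|)) * 3 / δ := by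
    gcongr <;> linarith
  refine hBC.trans ((add_le_add b1 b2).trans ?_)
  have : 0 ≤ 2 * (3/2) / δ * Real.sqrt |s.im| := by positivity
  have e : (A * 3 * (1 + Real.sqrt |s.im|)) * 3 / δ = 3 / δ * (A * 3) * (1 + Real.sqrt |s.im|) := by ring
  rw [e]; nlinarith

end PsiRH

namespace PsiRH
open Complex Topology

/-- one-sided Laplace transform at `s + 1` -/
def HasLap (f : ℝ → ℂ) (s v : ℂ) : Prop :=
  IntegrableOn (fun u : ℝ => f u * cexp (-(s + 1) * u)) (Set.Ioi 0) ∧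
    ∫ u in Set.Ioi (0:ℝ), f u * cexp (-(s + 1) * u) = v

lemma HasLap.add {f g : ℝ → ℂ} {s v w : ℂ} (hf : HasLap f s v) (hg : HasLap g s w) :
    HasLap (fun u => f u + g u) s (v + w) := by
  refine ⟨?_, ?_⟩
  · simp only [add_mul]; exact hf.1.add hg.1
  · simp only [add_mul]; rw [integral_add hf.1 hg.1, hf.2, hg.2]

lemma HasLap.sub {f g : ℝ → ℂ} {s v w : ℂ} (hf : HasLap f s v) (hg : HasLap g s w) :
    HasLap (fun u => f u - g u) s (v - w) := by
  refine ⟨?_, ?_⟩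
  · simp only [sub_mul]; exact hf.1.sub hg.1
  · simp only [sub_mul]; rw [integral_sub hf.1 hg.1, hf.2, hg.2]

lemma HasLap.const_mul {f : ℝ → ℂ} {s v : ℂ} (c : ℂ) (hf : HasLap f s v) :
    HasLap (fun u => c * f u) s (c * v) := by
  refine ⟨?_, ?_⟩
  · simp only [mul_assoc]; exact hf.1.const_mul c
  · simp only [mul_assoc]; rw [integral_const_mul, hf.2]

lemma HasLap.congr {f g : ℝ → ℂ} {s v w : ℂ} (hf : HasLap f s v) (h : ∀ u, 0 < u → g u = f u)
    (hv : v = w) : HasLap g s w := by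
  subst hv
  have he : Set.EqOn (fun u : ℝ => f u * cexp (-(s + 1) * u)) (fun u : ℝ => g u * cexp (-(s + 1) * u)) (Set.Ioi 0) := by
    intro u hu
    simp only [h u hu]
  refine ⟨hf.1.congr_fun he measurableSet_Ioi, ?_⟩
  rw [← setIntegral_congr_fun measurableSet_Ioi he, hf.2]

lemma hasLap_exp {s : ℂ} (k : ℝ) (hk : k < s.re + 1) :
    HasLap (fun u => ((Real.exp (k * u) : ℝ) : ℂ)) s (1 / (s + 1 - k)) := by
  have ha : ((k:ℂ) - (s + 1)).re < 0 := by simp; linarith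
  have e : (fun u : ℝ => ((Real.exp (k * u) : ℝ) : ℂ) * cexp (-(s + 1) * u)) = fun u : ℝ => cexp (((k:ℂ) - (s+1)) * u) := by
    ext u
    rw [Complex.ofReal_exp, ← Complex.exp_add]; congr 1; push_cast; ring
  refine ⟨?_, ?_⟩
  · rw [e]; exact integrableOn_exp_mul_complex_Ioi ha 0
  · rw [e, integral_exp_mul_complex_Ioi ha 0]
    simp only [ofReal_zero, mul_zero, Complex.exp_zero]
    rw [neg_div, ← div_neg]; congr 1; ring

lemma hasLap_q {s : ℂ} (hs : 0 < s.re) (n : ℕ) (hn : 1 ≤ n) :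
    HasLap (fun u => ((max (Real.exp u - n) 0 : ℝ) : ℂ)) s ((n:ℂ) ^ (-s) / (s * (s + 1))) := by
  have hn0 : (0:ℝ) < n := by exact_mod_cast hn
  have hlog : 0 ≤ Real.log n := Real.log_natCast_nonneg n
  have ha : (-s).re < 0 := by simpa using hs
  have hb : (-(s+1)).re < 0 := by simp; linarith
  have i1 := integrableOn_exp_mul_complex_Ioi ha (Real.log n)
  have i2 := (integrableOn_exp_mul_complex_Ioi hb (Real.log n)).const_mul (n:ℂ)
  have v1 := integral_exp_mul_complex_Ioi ha (Real.log n)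
  have v2 := integral_exp_mul_complex_Ioi hb (Real.log n)
  have e : ∀ u : ℝ, ((max (Real.exp u - n) 0 : ℝ) : ℂ) * cexp (-(s + 1) * u) =
      (Set.Ioi (Real.log n)).indicator (fun u : ℝ => cexp (-s * u) - n * cexp (-(s+1) * u)) u := by
    intro u
    by_cases hu : u ∈ Set.Ioi (Real.log n)
    · rw [Set.indicator_of_mem hu]
      have : (n:ℝ) < Real.exp u := (Real.log_lt_iff_lt_exp hn0).mp hu
      rw [max_eq_left (by linarith)]
      push_cast
      rw [sub_mul, ← Complex.exp_add]; congr 2; ring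
    · rw [Set.indicator_of_notMem hu]
      have : Real.exp u ≤ n := (Real.le_log_iff_exp_le hn0).mp (not_lt.mp hu)
      rw [max_eq_right (by linarith)]; simp
  have hsub : Set.Ioi (0:ℝ) ∩ Set.Ioi (Real.log n) = Set.Ioi (Real.log n) := by
    rw [Set.Ioi_inter_Ioi, max_eq_right hlog]
  have hcp : cexp (-s * (Real.log n : ℝ)) = (n:ℂ)^(-s) := by
    rw [Complex.cpow_def_of_ne_zero (by exact_mod_cast hn0.ne'), ← Complex.natCast_log]; congr 1; ring
  have hcp2 : cexp (-(s+1) * (Real.log n : ℝ)) = (n:ℂ)^(-s) / n := by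
    rw [← hcp, eq_div_iff (by exact_mod_cast hn0.ne')]
    have : (n:ℂ) = cexp (Real.log n : ℝ) := by
      rw [← Complex.ofReal_exp, Real.exp_log hn0]; simp
    rw [show -s * ((Real.log n : ℝ):ℂ) = -(s+1)*((Real.log n : ℝ):ℂ) + ((Real.log n : ℝ):ℂ) by ring, Complex.exp_add, ← this]
  have hs0 : s ≠ 0 := by rintro rfl; simp at hs
  have hs1 : s + 1 ≠ 0 := by
    intro h; have := congrArg Complex.re h; simp at this; linarith
  refine ⟨?_, ?_⟩
  · simp only [e]
    apply Integrable.integrableOn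
    exact (i1.sub i2).integrable_indicator measurableSet_Ioi
  · simp only [e]
    rw [setIntegral_indicator measurableSet_Ioi, hsub, integral_sub i1 i2, integral_const_mul, v1, v2, hcp, hcp2]
    have : (n:ℂ) ≠ 0 := by exact_mod_cast hn0.ne'
    generalize (n:ℂ)^(-s) = c
    field_simp
    ring

lemma HasLap.tsum {f : ℕ → ℝ → ℂ} {g : ℝ → ℂ} {s : ℂ} {v : ℕ → ℂ} {V : ℂ} (hf : ∀ n, HasLap (f n) s (v n))
    (hg : ContinuousOn g (Set.Ioi 0))
    (hsum : Summable fun n => ∫ u in Set.Ioi (0:ℝ), ‖f n u * cexp (-(s + 1) * u)‖)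
    (hfg : ∀ u, 0 < u → HasSum (fun n => f n u) (g u)) (hV : HasSum v V) : HasLap g s V := by
  have h1 := hasSum_integral_of_summable_integral_norm (fun n => (hf n).1) hsum
  have he : Set.EqOn (fun u : ℝ => ∑' n, f n u * cexp (-(s + 1) * u)) (fun u : ℝ => g u * cexp (-(s + 1) * u)) (Set.Ioi 0) := by
    intro u hu
    exact ((hfg u hu).mul_right _).tsum_eq
  rw [setIntegral_congr_fun measurableSet_Ioi he] at h1
  simp only [(hf _).2] at h1
  refine ⟨⟨?_, ?_⟩, h1.unique hV⟩
  · apply ContinuousOn.aestronglyMeasurable _ measurableSet_Ioi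
    apply hg.mul
    fun_prop
  · rw [hasFiniteIntegral_iff_enorm]
    calc ∫⁻ u in Set.Ioi (0:ℝ), ‖g u * cexp (-(s + 1) * u)‖ₑ
        ≤ ∫⁻ u in Set.Ioi (0:ℝ), ∑' n, ‖f n u * cexp (-(s + 1) * u)‖ₑ := by
          apply setLIntegral_mono' measurableSet_Ioi
          intro u hu
          have := he hu
          simp only at this
          rw [← this]
          exact enorm_tsum_le_tsum_enorm
      _ = ∑' n, ∫⁻ u in Set.Ioi (0:ℝ), ‖f n u * cexp (-(s + 1) * u)‖ₑ :=
          lintegral_tsum fun n => (hf n).1.1.enorm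
      _ = ∑' n, ENNReal.ofReal (∫ u in Set.Ioi (0:ℝ), ‖f n u * cexp (-(s + 1) * u)‖) := by
          congr 1; ext n
          rw [ofReal_integral_norm_eq_lintegral_enorm (hf n).1]
      _ < ⊤ := by
          rw [← ENNReal.ofReal_tsum_of_nonneg (fun n => integral_nonneg fun _ => norm_nonneg _) hsum]
          exact ENNReal.ofReal_lt_top

end PsiRH

namespace PsiRH
open Complex Topology

noncomputable def psi1 (x : ℝ) : ℝ := ∑' n : ℕ, ArithmeticFunction.vonMangoldt n * max (x - n) 0

lemma psi1_hasSum (x : ℝ) (N : ℕ) (h : x ≤ N) :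
    HasSum (fun n : ℕ => ArithmeticFunction.vonMangoldt n * max (x - n) 0)
      (∑ n ∈ Finset.range N, ArithmeticFunction.vonMangoldt n * max (x - n) 0) := by
  apply hasSum_sum_of_ne_finset_zero
  intro n hn
  have : N ≤ n := by simpa using hn
  have : (N:ℝ) ≤ n := by exact_mod_cast this
  rw [max_eq_right (by linarith), mul_zero]

lemma psi1_eq (x : ℝ) (N : ℕ) (h : x ≤ N) :
    psi1 x = ∑ n ∈ Finset.range N, ArithmeticFunction.vonMangoldt n * max (x - n) 0 :=
  (psi1_hasSum x N h).tsum_eq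

lemma psi1_hasSum' (x : ℝ) :
    HasSum (fun n : ℕ => ArithmeticFunction.vonMangoldt n * max (x - n) 0) (psi1 x) := by
  obtain ⟨N, hN⟩ := exists_nat_ge x
  rw [psi1_eq x N hN]; exact psi1_hasSum x N hN

lemma psi1_cont : Continuous psi1 := by
  rw [continuous_iff_continuousAt]
  intro x
  obtain ⟨N, hN⟩ := exists_nat_gt x
  have : psi1 =ᶠ[𝓝 x] fun x => ∑ n ∈ Finset.range N, ArithmeticFunction.vonMangoldt n * max (x - n) 0 := by
    filter_upwards [Iio_mem_nhds hN] with y hy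
    exact psi1_eq y N (le_of_lt hy)
  apply ContinuousAt.congr _ this.symm
  apply Continuous.continuousAt
  fun_prop

noncomputable def gT (n : ℕ) (u : ℝ) : ℝ := 1 / ((2 * n + 2) * (2 * n + 1)) * (1 - Real.exp (-(2 * n + 1) * u))

noncomputable def g (u : ℝ) : ℝ := ∑' n : ℕ, gT n u

lemma gT_nonneg (n : ℕ) {u : ℝ} (hu : 0 ≤ u) : 0 ≤ gT n u := by
  unfold gT
  apply mul_nonneg (by positivity)
  have : Real.exp (-(2 * n + 1) * u) ≤ 1 := by
    apply Real.exp_le_one_iff.mpr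
    have : 0 ≤ (2 * (n:ℝ) + 1) * u := by positivity
    linarith
  linarith

lemma gc_le (n : ℕ) : 1 / ((2 * (n:ℝ) + 2) * (2 * n + 1)) ≤ 1 / ((n:ℝ) + 1)^2 := by
  gcongr
  have : (0:ℝ) ≤ n := Nat.cast_nonneg n
  nlinarith

lemma gT_le (n : ℕ) {u : ℝ} : gT n u ≤ 1 / ((n:ℝ) + 1)^2 := by
  unfold gT
  refine le_trans ?_ (gc_le n)
  have := Real.exp_pos (-(2 * n + 1) * u)
  have h2 : (0:ℝ) ≤ 1 / ((2 * (n:ℝ) + 2) * (2 * n + 1)) := by positivity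
  nlinarith

lemma sq_hasSum : HasSum (fun n : ℕ => 1 / ((n:ℝ) + 1)^2) (Real.pi^2/6) := by
  have := (hasSum_nat_add_iff' 1).mpr hasSum_zeta_two
  simpa using this

lemma g_hasSum {u : ℝ} (hu : 0 ≤ u) : HasSum (fun n => gT n u) (g u) :=
  (Summable.of_nonneg_of_le (fun n => gT_nonneg n hu) (fun n => gT_le n) sq_hasSum.summable).hasSum

lemma g_nonneg {u : ℝ} (hu : 0 ≤ u) : 0 ≤ g u := tsum_nonneg fun n => gT_nonneg n hu

lemma g_le {u : ℝ} (hu : 0 ≤ u) : g u ≤ 2 := by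
  have h := hasSum_le (fun n => gT_le n (u := u)) (g_hasSum hu) sq_hasSum
  have := Real.pi_lt_d2
  have := Real.pi_pos
  nlinarith

lemma g_cont : ContinuousOn g (Set.Ici 0) := by
  unfold g
  apply continuousOn_tsum (u := fun n : ℕ => 1 / ((n:ℝ) + 1)^2) _ sq_hasSum.summable
  · intro n u hu
    rw [Real.norm_eq_abs, abs_of_nonneg (gT_nonneg n hu)]
    exact gT_le n
  · intro n
    unfold gT
    fun_prop

noncomputable def kap : ℝ := Real.log Real.pi / 2 + Real.eulerMascheroniConstant / 2

noncomputable def E (u : ℝ) : ℝ := psi1 (Real.exp u) - (Real.exp u - 1)^2/2 + kap * (Real.exp u - 1) - g u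

lemma E_cont : ContinuousOn E (Set.Ici 0) := by
  unfold E
  apply ContinuousOn.sub _ g_cont
  apply Continuous.continuousOn
  have := psi1_cont
  fun_prop

lemma E_zero : E 0 = 0 := by
  have h1 : psi1 1 = 0 := by rw [psi1_eq 1 1 (by simp)]; simp
  have h2 : g 0 = 0 := by unfold g gT; simp
  unfold E
  simp [h1, h2]

lemma hasLap_psi {s : ℂ} (hs : 1 < s.re) : HasLap (fun u => ((psi1 (Real.exp u) : ℝ) : ℂ)) s
    (-(deriv riemannZeta s / riemannZeta s) / (s * (s + 1))) := by
  have hs0 : s ≠ 0 := by rintro rfl; simp at hs; linarith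
  set f : ℕ → ℝ → ℂ := fun n u => (ArithmeticFunction.vonMangoldt n : ℂ) * ((max (Real.exp u - n) 0 : ℝ) : ℂ) with hf
  set v : ℂ → ℕ → ℂ := fun s n => LSeries.term (fun n => (ArithmeticFunction.vonMangoldt n : ℂ)) s n / (s * (s + 1)) with hv
  have hlap : ∀ s : ℂ, 1 < s.re → ∀ n, HasLap (f n) s (v s n) := by
    intro s hs n
    rcases Nat.eq_zero_or_pos n with rfl | hn
    · refine ⟨?_, ?_⟩ <;> simp [hf, hv]
    · refine ((hasLap_q (s := s) (by linarith) n hn).const_mul (ArithmeticFunction.vonMangoldt n : ℂ)).congr (fun u _ => rfl) ?_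
      simp only [hv]
      rw [LSeries.term_of_ne_zero hn.ne', Complex.cpow_neg]
      ring
  apply HasLap.tsum (hlap s hs)
  · apply Continuous.continuousOn
    have := psi1_cont
    fun_prop
  · have hσ : (1:ℝ) < ((s.re : ℝ) : ℂ).re := by simpa using hs
    have hS := (ArithmeticFunction.LSeriesSummable_vonMangoldt hσ).div_const ((s.re : ℂ) * (s.re + 1))
    refine hS.norm.congr ?_
    intro n
    have h1 := (hlap (s.re : ℂ) hσ n).2
    have h2 : ∀ u : ℝ, f n u * cexp (-((s.re : ℂ) + 1) * u) = ((‖f n u * cexp (-(s + 1) * u)‖ : ℝ) : ℂ) := by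
      intro u
      rw [norm_mul, Complex.norm_exp]
      simp only [hf]
      rw [norm_mul, Complex.norm_real, Complex.norm_real, Real.norm_eq_abs, Real.norm_eq_abs,
        abs_of_nonneg ArithmeticFunction.vonMangoldt_nonneg, abs_of_nonneg (le_max_right _ _)]
      push_cast
      congr 2
      simp
    simp only [h2] at h1
    rw [integral_complex_ofReal] at h1
    simp only [hv] at h1
    rw [← h1, Complex.norm_real, Real.norm_eq_abs, abs_of_nonneg (integral_nonneg fun _ => norm_nonneg _)]
  · intro u hu
    have := (psi1_hasSum' (Real.exp u))
    have h2 := Complex.hasSum_ofReal.mpr this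
    refine h2.congr_fun ?_
    intro n
    simp [hf]
  · have hS := (ArithmeticFunction.LSeriesSummable_vonMangoldt hs).hasSum
    have h := ArithmeticFunction.LSeries_vonMangoldt_eq_deriv_riemannZeta_div hs
    rw [LSeries] at h
    rw [h, neg_div] at hS
    exact hS.div_const _

lemma hasLap_g {s : ℂ} (hs : 0 < s.re) : HasLap (fun u => ((g u : ℝ) : ℂ)) s
    (D s / (s * (s + 1))) := by
  have hs0 : s ≠ 0 := by rintro rfl; simp at hs
  have hs1 : s + 1 ≠ 0 := by
    intro h; have := congrArg Complex.re h; simp at this; linarith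
  have hlap : ∀ n : ℕ, HasLap (fun u => ((gT n u : ℝ):ℂ)) s
      ((1 / (2 * ((n:ℂ) + 1)) - 1 / (2 * ((n:ℂ) + 1) + s)) / (s * (s + 1))) := by
    intro n
    have hn : (0:ℝ) ≤ n := Nat.cast_nonneg n
    refine (((hasLap_exp (s := s) 0 (by linarith)).sub (hasLap_exp (s := s) (-(2 * n + 1)) (by linarith))).const_mul
      (1 / ((2 * n + 2) * (2 * n + 1)))).congr ?_ ?_
    · intro u _
      unfold gT
      simp
    · have e1 : (2 * (n:ℂ) + 1) ≠ 0 := by exact_mod_cast (show (2 * (n:ℝ) + 1) ≠ 0 by positivity)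
      have e2 : ((n:ℂ) + 1) ≠ 0 := by exact_mod_cast (show ((n:ℝ) + 1) ≠ 0 by positivity)
      have e4 : (2 * (n:ℂ) + 2) ≠ 0 := by exact_mod_cast (show (2 * (n:ℝ) + 2) ≠ 0 by positivity)
      have e3 : (2 * ((n:ℂ) + 1) + s) ≠ 0 := by
        intro h; have := two_mul_re_pos hs n; rw [h] at this; simp at this
      have e5 : s + 1 - ((-(2 * (n:ℝ) + 1) : ℝ) : ℂ) ≠ 0 := by
        convert e3 using 1; push_cast; ring
      have e6 : s + 1 - ((-(2 * (n:ℝ) + 1) : ℝ) : ℂ) = 2 * ((n:ℂ) + 1) + s := by push_cast; ring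
      rw [e6, show (2 * (n:ℂ) + 2) = 2 * ((n:ℂ)+1) by ring]
      simp only [ofReal_zero, sub_zero]
      field_simp
      ring
  apply HasLap.tsum hlap
  · exact Complex.continuous_ofReal.comp_continuousOn (g_cont.mono Set.Ioi_subset_Ici_self)
  · have hI := (hasLap_exp (s := s) 0 (by linarith)).1.norm
    refine Summable.of_nonneg_of_le (fun n => integral_nonneg fun _ => norm_nonneg _) ?_
      (sq_hasSum.summable.mul_right (∫ u in Set.Ioi (0:ℝ), ‖((Real.exp (0 * u) : ℝ) : ℂ) * cexp (-(s + 1) * u)‖))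
    intro n
    rw [← integral_const_mul]
    apply setIntegral_mono_on (hlap n).1.norm (hI.const_mul _) measurableSet_Ioi
    intro u hu
    rw [norm_mul, norm_mul, ← mul_assoc]
    gcongr
    rw [Complex.norm_real, Real.norm_eq_abs, abs_of_nonneg (gT_nonneg n (le_of_lt hu))]
    simpa using gT_le n (u := u)
  · intro u hu
    exact Complex.hasSum_ofReal.mpr (g_hasSum hu.le)
  · exact (D_summable hs).hasSum.div_const _

noncomputable def H (s : ℂ) : ℂ := -F s / (s * (s + 1))

lemma hasLap_E {s : ℂ} (hs : 1 < s.re) : HasLap (fun u => ((E u : ℝ) : ℂ)) s (H s) := by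
  have e1 := hasLap_exp (s := s) 1 (by linarith)
  have e2 := hasLap_exp (s := s) 2 (by linarith)
  have e0 := hasLap_exp (s := s) 0 (by linarith)
  have h1 := ((e2.const_mul (1/2)).sub e1).add (e0.const_mul (1/2))
  have h2 := (e1.sub e0).const_mul (kap : ℂ)
  have h := (((hasLap_psi hs).sub h1).add h2).sub (hasLap_g (s := s) (by linarith))
  refine h.congr ?_ ?_
  · intro u _
    unfold E
    have : Real.exp (2 * u) = Real.exp u ^ 2 := by rw [← Real.exp_nat_mul]; simp
    rw [this]
    simp
    ring
  · obtain ⟨z1, z2⟩ := zeta_ne hs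
    rw [H, F_eq (by linarith) z1 z2, kap]
    have hs0 : s ≠ 0 := by rintro rfl; simp at hs; linarith
    have hs1 : s + 1 ≠ 0 := by
      intro h; have := congrArg Complex.re h; simp at this; linarith
    have hs2 : s - 1 ≠ 0 := sub_ne_zero.mpr z1
    push_cast
    rw [show s + 1 - 1 = s by ring, show s + 1 - 2 = s - 1 by ring, sub_zero]
    generalize deriv riemannZeta s / riemannZeta s = zz
    field_simp
    ring

end PsiRH

namespace PsiRH
open Complex Topology

lemma one_add_integrable : Integrable (fun t : ℝ => (1 + |t|) ^ (-(3/2) : ℝ)) := by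
  have := integrable_one_add_norm (E := ℝ) (μ := volume) (r := 3/2) (by simp; norm_num)
  simpa [Real.norm_eq_abs] using this

lemma H_diffAt (hRH : RiemannHypothesis) {s : ℂ} (hs : 1/2 < s.re) : DifferentiableAt ℂ H s := by
  have hs0 : s ≠ 0 := by rintro rfl; norm_num at hs
  have hs1 : s + 1 ≠ 0 := by
    intro h; have := congrArg Complex.re h; simp at this; linarith
  unfold H
  exact DifferentiableAt.fun_div (F_diffAt hRH hs).fun_neg (by fun_prop) (mul_ne_zero hs0 hs1)

lemma norm_lower {s : ℂ} (hs : 1/2 ≤ s.re) : (1 + |s.im|)/4 ≤ ‖s‖ := by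
  have h1 := Complex.abs_re_le_norm s
  have h2 := Complex.abs_im_le_norm s
  have h3 := le_abs_self s.re
  linarith

lemma H_bound (hRH : RiemannHypothesis) {δ : ℝ} (hδ : 0 < δ) : ∃ C, 0 ≤ C ∧ ∀ s : ℂ, 1/2 + δ ≤ s.re → s.re ≤ 2 →
    ‖H s‖ ≤ C * (1 + |s.im|) ^ (-(3/2) : ℝ) := by
  obtain ⟨C, hC, h⟩ := F_growth hRH hδ
  refine ⟨32 * C, by positivity, fun s h1 h2 => ?_⟩
  have hF := h s h1 h2
  set y := 1 + |s.im| with hy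
  have hy0 : 0 < y := by positivity
  have l1 : y / 4 ≤ ‖s‖ := norm_lower (by linarith)
  have l2 : y / 4 ≤ ‖s + 1‖ := by
    have := norm_lower (s := s + 1) (by simp; linarith)
    simpa using this
  have hsq : 1 + √|s.im| ≤ 2 * √y := by
    have a1 : √|s.im| ≤ √y := Real.sqrt_le_sqrt (by simp [hy])
    have a2 : 1 ≤ √y := by
      rw [Real.one_le_sqrt]; simp [hy]
    linarith
  have hp : y ^ (-(3/2) : ℝ) = √y / y^2 := by
    rw [Real.sqrt_eq_rpow, ← Real.rpow_natCast, ← Real.rpow_sub hy0]; norm_num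
  unfold H
  rw [norm_div, norm_neg, norm_mul, hp]
  calc ‖F s‖ / (‖s‖ * ‖s + 1‖) ≤ (C * (2 * √y)) / (y/4 * (y/4)) := by
        gcongr
        exact hF.trans (by gcongr)
    _ = 32 * C * (√y / y^2) := by field_simp; ring

lemma shift {f : ℂ → ℂ} {a b C : ℝ} (_hab : a ≤ b)
    (hd : ∀ s : ℂ, a ≤ s.re → s.re ≤ b → DifferentiableAt ℂ f s)
    (hb : ∀ s : ℂ, a ≤ s.re → s.re ≤ b → ‖f s‖ ≤ C * (1 + |s.im|) ^ (-(3/2) : ℝ)) :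
    ∀ c : ℝ, a ≤ c → c ≤ b → Integrable (fun t : ℝ => f (c + t * I)) := by
  intro c h1 h2
  refine (one_add_integrable.const_mul C).mono' ?_ (ae_of_all _ fun t => ?_)
  · apply Continuous.aestronglyMeasurable
    rw [continuous_iff_continuousAt]
    intro t
    refine ContinuousAt.comp (g := f) (f := fun t : ℝ => (c : ℂ) + t * I) ?_ (by fun_prop)
    exact (hd _ (by simpa using h1) (by simpa using h2)).continuousAt
  · simpa using hb (c + t * I) (by simpa using h1) (by simpa using h2)

lemma shift_eq {f : ℂ → ℂ} {a b C : ℝ} (hab : a ≤ b)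
    (hd : ∀ s : ℂ, a ≤ s.re → s.re ≤ b → DifferentiableAt ℂ f s)
    (hb : ∀ s : ℂ, a ≤ s.re → s.re ≤ b → ‖f s‖ ≤ C * (1 + |s.im|) ^ (-(3/2) : ℝ)) :
    ∫ t : ℝ, f (a + t * I) = ∫ t : ℝ, f (b + t * I) := by
  have ia := shift hab hd hb a le_rfl hab
  have ib := shift hab hd hb b hab le_rfl
  have ta := intervalIntegral_tendsto_integral ia tendsto_neg_atTop_atBot tendsto_id
  have tb := intervalIntegral_tendsto_integral ib tendsto_neg_atTop_atBot tendsto_id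
  have hz : Tendsto (fun T : ℝ => C * (1 + |T|) ^ (-(3/2) : ℝ) * |b - a|) atTop (𝓝 0) := by
    have : Tendsto (fun T : ℝ => (1 + |T|) ^ (-(3/2) : ℝ)) atTop (𝓝 0) :=
      (tendsto_rpow_neg_atTop (by norm_num)).comp (tendsto_atTop_add_const_left _ _ tendsto_abs_atTop_atTop)
    simpa using (this.const_mul C).mul_const |b - a|
  have hh : ∀ T : ℝ, ‖∫ x in a..b, f (x + T * I)‖ ≤ C * (1 + |T|) ^ (-(3/2) : ℝ) * |b - a| := by
    intro T
    apply intervalIntegral.norm_integral_le_of_norm_le_const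
    intro x hx
    rw [Set.uIoc_of_le hab] at hx
    simpa using hb (x + T * I) (by simpa using hx.1.le) (by simpa using hx.2)
  have t1 : Tendsto (fun T : ℝ => ∫ x in a..b, f (x + T * I)) atTop (𝓝 0) := squeeze_zero_norm hh hz
  have t2 : Tendsto (fun T : ℝ => ∫ x in a..b, f (x + ((-T : ℝ) : ℂ) * I)) atTop (𝓝 0) := by
    apply squeeze_zero_norm (fun T => hh (-T))
    simpa using hz
  have hrect : ∀ T : ℝ, (∫ x : ℝ in a..b, f (x + ((-T : ℝ) : ℂ) * I)) - (∫ x : ℝ in a..b, f (x + T * I)) +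
      I • (∫ y : ℝ in (-T)..T, f (b + y * I)) - I • (∫ y : ℝ in (-T)..T, f (a + y * I)) = 0 := by
    intro T
    have := integral_boundary_rect_eq_zero_of_differentiableOn f (⟨a, -T⟩ : ℂ) (⟨b, T⟩ : ℂ) ?_
    · simpa using this
    · intro s hs
      rw [mem_reProdIm] at hs
      have h := hs.1
      simp only [Set.uIcc_of_le hab] at h
      exact (hd s h.1 h.2).differentiableWithinAt
  have tt := (((t2.sub t1).add (tb.const_smul I)).sub (ta.const_smul I))
  simp only [id] at tt
  have tt0 := tt.congr hrect
  have := tendsto_nhds_unique tt0 tendsto_const_nhds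
  simp only [smul_eq_mul, sub_self, zero_add, ← mul_sub] at this
  rcases mul_eq_zero.mp this with h | h
  · exact absurd h I_ne_zero
  · exact (sub_eq_zero.mp h).symm

noncomputable def EE (u : ℝ) : ℝ := E (max u 0)

lemma EE_cont : Continuous EE := by
  unfold EE
  have : Continuous (fun u : ℝ => max u 0) := by fun_prop
  exact E_cont.comp_continuous this (fun x => Set.mem_Ici.mpr (le_max_right _ _))

lemma EE_nonpos {u : ℝ} (hu : u ≤ 0) : EE u = 0 := by
  unfold EE; rw [max_eq_right hu, E_zero]

lemma EE_pos {u : ℝ} (hu : 0 ≤ u) : EE u = E u := by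
  unfold EE; rw [max_eq_left hu]

lemma EE_lap {s : ℂ} (hs : 1 < s.re) : Integrable (fun u : ℝ => (EE u : ℂ) * cexp (-(s+1) * u)) ∧
    ∫ u : ℝ, (EE u : ℂ) * cexp (-(s+1) * u) = H s := by
  obtain ⟨h1, h2⟩ := hasLap_E hs
  have e : (fun u : ℝ => (EE u : ℂ) * cexp (-(s+1) * u)) =
      (Set.Ioi (0:ℝ)).indicator (fun u : ℝ => (E u : ℂ) * cexp (-(s+1) * u)) := by
    ext u
    by_cases hu : u ∈ Set.Ioi (0:ℝ)
    · rw [Set.indicator_of_mem hu, EE_pos (le_of_lt hu)]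
    · rw [Set.indicator_of_notMem hu, EE_nonpos (not_lt.mp hu)]; simp
  rw [e]
  exact ⟨h1.integrable_indicator measurableSet_Ioi, by rw [integral_indicator measurableSet_Ioi]; exact h2⟩

lemma inv_two (hRH : RiemannHypothesis) (u : ℝ) :
    ∫ t : ℝ, cexp (((2:ℝ) + t * I + 1) * u) * H ((2:ℝ) + t * I) = 2 * Real.pi * EE u := by
  set f : ℝ → ℂ := fun u => (EE u : ℂ) * cexp (-(2+1) * u) with hf
  have hfc : Continuous f := by
    have := EE_cont
    fun_prop
  have hfi : Integrable f := (EE_lap (s := 2) (by simp)).1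
  have hFf : FourierTransform.fourier f = fun ξ : ℝ => H ((2:ℝ) + ((2 * Real.pi * ξ : ℝ) : ℂ) * I) := by
    ext ξ
    rw [Real.fourier_real_eq_integral_exp_smul, ← (EE_lap (s := (2:ℝ) + ((2 * Real.pi * ξ : ℝ) : ℂ) * I) (by simp)).2]
    congr 1
    ext v
    simp only [hf, smul_eq_mul]
    rw [mul_left_comm, ← Complex.exp_add]
    congr 2
    push_cast; ring
  obtain ⟨C, hC, hb⟩ := H_bound hRH (δ := 1) (by norm_num)
  have hHi : Integrable (fun t : ℝ => H ((2:ℝ) + t * I)) :=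
    shift (a := 2) (b := 2) le_rfl (fun s h _ => H_diffAt hRH (by linarith))
      (fun s h1 h2 => hb s (by linarith) h2) 2 le_rfl le_rfl
  have hpi : (2 * Real.pi) ≠ 0 := by positivity
  have hi : Integrable (FourierTransform.fourier f) := by
    rw [hFf]
    exact hHi.comp_mul_left' hpi
  have inv := congrFun (hfc.fourierInv_fourier_eq hfi hi) u
  rw [Real.fourierInv_eq', hFf] at inv
  have key := Measure.integral_comp_mul_left (fun t : ℝ => cexp (((2:ℝ) + t * I + 1) * u) * H ((2:ℝ) + t * I)) (2 * Real.pi)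
  have e2 : (∫ x : ℝ, cexp (((2:ℝ) + ((2 * Real.pi * x : ℝ) : ℂ) * I + 1) * u) * H ((2:ℝ) + ((2 * Real.pi * x : ℝ) : ℂ) * I))
      = cexp (3 * u) * f u := by
    rw [← inv, ← integral_const_mul]
    congr 1
    ext x
    rw [smul_eq_mul, ← mul_assoc, ← Complex.exp_add]
    congr 2
    simp
    ring
  rw [e2] at key
  simp only [hf] at key
  rw [mul_left_comm, ← Complex.exp_add] at key
  rw [show (3 * (u:ℂ) + -(2+1) * u) = 0 by ring, Complex.exp_zero, mul_one, abs_of_pos (by positivity), Complex.real_smul] at key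
  rw [key]
  generalize (∫ t : ℝ, cexp (((2:ℝ) + t * I + 1) * u) * H ((2:ℝ) + t * I)) = J
  push_cast
  have : (Real.pi : ℂ) ≠ 0 := by exact_mod_cast Real.pi_ne_zero
  field_simp

lemma inv_alpha (hRH : RiemannHypothesis) {α : ℝ} (hα : 1/2 < α) (hα2 : α ≤ 2) :
    Integrable (fun t : ℝ => H (α + t * I)) ∧ ∀ u : ℝ,
    ∫ t : ℝ, H (α + t * I) * cexp (t * u * I) = 2 * Real.pi * (EE u * Real.exp (-(α + 1) * u) : ℝ) := by
  obtain ⟨C, hC, hb⟩ := H_bound hRH (δ := α - 1/2) (by linarith)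
  refine ⟨shift (a := α) (b := 2) hα2 (fun s h _ => H_diffAt hRH (by linarith))
      (fun s h1 h2 => hb s (by linarith) h2) α le_rfl hα2, fun u => ?_⟩
  have hs := shift_eq (f := fun s => cexp ((s + 1) * u) * H s) (a := α) (b := 2) (C := Real.exp (3 * |u|) * C) hα2
    (fun s h1 h2 => (by fun_prop : DifferentiableAt ℂ (fun s : ℂ => cexp ((s + 1) * u)) s).mul (H_diffAt hRH (by linarith))) ?_
  · rw [inv_two hRH u] at hs
    have e : ∀ t : ℝ, H (α + t * I) * cexp (t * u * I) = cexp (-(α + 1) * u) * (cexp ((α + t * I + 1) * u) * H (α + t * I)) := by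
      intro t
      rw [← mul_assoc, ← Complex.exp_add, mul_comm]
      congr 2
      ring
    simp only [e]
    rw [integral_const_mul, hs]
    push_cast
    ring
  · intro s h1 h2
    rw [norm_mul, mul_assoc]
    gcongr
    · rw [Complex.norm_exp]
      apply Real.exp_le_exp.mpr
      simp
      have := le_abs_self u
      have := abs_nonneg u
      nlinarith
    · exact hb s (by linarith) h2

end PsiRH

namespace PsiRH
open Complex Topology

lemma c_sub_ne {c : ℝ} (hc : 0 < c) (t : ℝ) : (c:ℂ) - t * I ≠ 0 := by
  intro h; have := congrArg Complex.re h; simp at this; linarith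

lemma c_add_ne {c : ℝ} (hc : 0 < c) (t : ℝ) : (c:ℂ) + t * I ≠ 0 := by
  intro h; have := congrArg Complex.re h; simp at this; linarith

lemma norm_inv_le {c : ℝ} (hc : 0 < c) (t : ℝ) : ‖((c:ℂ) - t * I)⁻¹‖ ≤ c⁻¹ := by
  rw [norm_inv]
  gcongr
  have := Complex.abs_re_le_norm ((c:ℂ) - t * I)
  simp at this
  rwa [abs_of_pos hc] at this

lemma norm_cexp_I (t u : ℝ) : ‖cexp (t * u * I)‖ = 1 := by
  rw [← Complex.ofReal_mul]; exact Complex.norm_exp_ofReal_mul_I _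

lemma fub {Φ : ℝ → ℂ} (hΦ : Integrable Φ) {c : ℝ} (hc : 0 < c) (w : ℝ) :
    ∫ v in Set.Ioi (0:ℝ), (Real.exp (-c * v) : ℂ) * ∫ t : ℝ, Φ t * cexp (t * (w + v : ℝ) * I) =
      ∫ t : ℝ, Φ t * cexp (t * w * I) * ((c:ℂ) - t * I)⁻¹ := by
  have hg : Integrable (fun v : ℝ => (Real.exp (-c * v) : ℂ)) (volume.restrict (Set.Ioi 0)) := by
    have := integrableOn_exp_mul_complex_Ioi (a := (-c : ℂ)) (by simpa using hc) 0
    refine this.congr (ae_of_all _ fun v => ?_)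
    simp
  have hp : Integrable (fun z : ℝ × ℝ => (Real.exp (-c * z.1) : ℂ) * (Φ z.2 * cexp (z.2 * (w + z.1 : ℝ) * I)))
      ((volume.restrict (Set.Ioi (0:ℝ))).prod volume) := by
    have h0 := hg.mul_prod hΦ
    have h1 := h0.bdd_mul (f := fun z : ℝ × ℝ => cexp (z.2 * (w + z.1 : ℝ) * I)) (c := 1)
      (Continuous.aestronglyMeasurable (by fun_prop)) (ae_of_all _ fun z => (norm_cexp_I _ _).le)
    refine h1.congr (ae_of_all _ fun z => ?_)
    ring
  have hsw := integral_integral_swap (f := fun v t : ℝ => (Real.exp (-c * v) : ℂ) * (Φ t * cexp (t * (w + v : ℝ) * I))) hp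
  simp only [integral_const_mul] at hsw
  rw [hsw]
  congr 1
  ext t
  have e : ∀ v : ℝ, (Real.exp (-c * v) : ℂ) * (Φ t * cexp (t * (w + v : ℝ) * I)) =
      Φ t * cexp (t * w * I) * cexp (-((c:ℂ) - t * I) * v) := by
    intro v
    rw [mul_left_comm, mul_assoc (Φ t), Complex.ofReal_exp, ← Complex.exp_add, ← Complex.exp_add]
    congr 2
    push_cast
    ring
  simp only [e]
  rw [integral_const_mul, integral_exp_mul_complex_Ioi (by simpa using hc)]
  rw [neg_div_neg_eq]
  simp

lemma H_real {σ : ℝ} (hσ : 1 < σ) : H σ = ((∫ u : ℝ, EE u * Real.exp (-(σ+1) * u) : ℝ) : ℂ) := by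
  rw [← (EE_lap (s := (σ:ℂ)) (by simpa using hσ)).2, ← integral_complex_ofReal]
  congr 1
  ext u
  push_cast
  rfl

lemma lemQ (hRH : RiemannHypothesis) {α c : ℝ} (hα : 1/2 < α) (hα2 : α ≤ 2) (hc : 0 < c) (hcα : 1 < c + α)
    {u : ℝ} (hu : 0 ≤ u) :
    ∫ t : ℝ, H (α + t * I) * cexp (t * (-u : ℝ) * I) * ((c:ℂ) - t * I)⁻¹ =
      2 * Real.pi * (Real.exp (-c * u) * H ((c + α : ℝ) : ℂ)) := by
  obtain ⟨hi, h⟩ := inv_alpha hRH hα hα2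
  rw [← fub hi hc (-u), H_real hcα]
  simp only [h]
  have e1 : ∀ v : ℝ, (Real.exp (-c * v) : ℂ) * (2 * Real.pi * (EE (-u + v) * Real.exp (-(α + 1) * (-u + v)) : ℝ)) =
      ((2 * Real.pi * (Real.exp (-c * u) * (EE (-u + v) * Real.exp (-(c + α + 1) * (-u + v)))) : ℝ) : ℂ) := by
    intro v
    have : Real.exp (-(c + α + 1) * (-u + v)) = Real.exp (c * u) * Real.exp (-c * v) * Real.exp (-(α + 1) * (-u + v)) := by
      rw [← Real.exp_add, ← Real.exp_add]; congr 1; ring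
    have h2 : Real.exp (-c * u) * Real.exp (c * u) = 1 := by rw [← Real.exp_add]; simp
    rw [this]
    have : Real.exp (-c * u) * (EE (-u + v) * (Real.exp (c * u) * Real.exp (-c * v) * Real.exp (-(α + 1) * (-u + v)))) =
      (Real.exp (-c * u) * Real.exp (c * u)) * (Real.exp (-c * v) * (EE (-u + v) * Real.exp (-(α + 1) * (-u + v)))) := by ring
    rw [this, h2]
    push_cast
    ring
  simp only [e1]
  rw [integral_complex_ofReal]
  simp only [integral_const_mul]
  have e2 : ∫ v in Set.Ioi (0:ℝ), EE (-u + v) * Real.exp (-(c + α + 1) * (-u + v)) =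
      ∫ v : ℝ, EE (-u + v) * Real.exp (-(c + α + 1) * (-u + v)) := by
    apply setIntegral_eq_integral_of_forall_compl_eq_zero
    intro v hv
    have : v ≤ 0 := not_lt.mp hv
    rw [EE_nonpos (by linarith), zero_mul]
  rw [e2, integral_add_left_eq_self (fun v => EE v * Real.exp (-(c + α + 1) * v))]
  push_cast
  ring

lemma main_alpha (hRH : RiemannHypothesis) {α : ℝ} (hα : 1/2 < α) (hα2 : α ≤ 2) {u : ℝ} (hu : 0 ≤ u) :
    ‖((EE u * Real.exp (-(α + 1) * u) : ℝ) : ℂ) - Real.exp (-α * u) * F ((2 * α : ℝ) : ℂ) +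
      Real.exp (-(α+1) * u) * F ((2 * α + 1 : ℝ) : ℂ)‖ ≤ (F ((2 * α : ℝ) : ℂ)).re / α := by
  obtain ⟨hi, h⟩ := inv_alpha hRH hα hα2
  have hα0 : 0 < α := by linarith
  have hβ0 : 0 < α + 1 := by linarith
  set Φ : ℝ → ℂ := fun t => H (α + t * I) with hΦ
  have hk : ∀ t : ℝ, F (α + t * I) = -Φ t * ((α + t * I) * ((α + 1 : ℝ) + t * I)) := by
    intro t
    have h1 := c_add_ne hα0 t
    have h2 := c_add_ne hβ0 t
    push_cast at h2 ⊢
    simp only [hΦ, H]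
    rw [show (α:ℂ) + t * I + 1 = α + 1 + t * I by ring]
    field_simp
  -- the positive kernel
  set P : ℝ → ℝ := fun t => (F (α + t * I)).re / (α^2 + t^2) with hP
  have hPc : ∀ t : ℝ, F (α + t * I) / ((α^2 + t^2 : ℝ) : ℂ) =
      Φ t * cexp (t * (0:ℝ) * I) - (2 * α + 1) * (Φ t * cexp (t * (-0:ℝ) * I) * ((α:ℂ) - t * I)⁻¹) := by
    intro t
    rw [hk]
    have h1 := c_add_ne hα0 t
    have h2 := c_sub_ne hα0 t
    have h3 : ((α^2 + t^2 : ℝ) : ℂ) = (α + t * I) * (α - t * I) := by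
      push_cast; linear_combination ((t:ℂ)^2) * I_sq
    rw [h3]
    simp only [ofReal_zero, neg_zero, mul_zero, zero_mul, Complex.exp_zero, mul_one]
    push_cast
    field_simp
    ring
  have hbd : ∀ (c : ℝ) (_ : 0 < c) (u : ℝ), Integrable (fun t : ℝ => Φ t * cexp (t * (u:ℝ) * I) * ((c:ℂ) - t * I)⁻¹) := by
    intro c hc u
    have := hi.bdd_mul (f := fun t : ℝ => cexp (t * (u:ℝ) * I) * ((c:ℂ) - t * I)⁻¹) (c := 1 * c⁻¹)
      (Continuous.aestronglyMeasurable (by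
        apply Continuous.mul (by fun_prop)
        exact Continuous.inv₀ (by fun_prop) (fun t => c_sub_ne hc t)))
      (ae_of_all _ fun t => by
        rw [norm_mul, norm_cexp_I]; gcongr; exact norm_inv_le hc t)
    refine this.congr (ae_of_all _ fun t => ?_)
    ring
  have hbd0 : ∀ (u : ℝ), Integrable (fun t : ℝ => Φ t * cexp (t * (u:ℝ) * I)) := by
    intro u
    have := hi.bdd_mul (f := fun t : ℝ => cexp (t * (u:ℝ) * I)) (c := 1)
      (Continuous.aestronglyMeasurable (by fun_prop)) (ae_of_all _ fun t => (norm_cexp_I _ _).le)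
    refine this.congr (ae_of_all _ fun t => ?_)
    ring
  have hPi : Integrable (fun t : ℝ => F (α + t * I) / ((α^2 + t^2 : ℝ) : ℂ)) := by
    simp only [hPc]
    exact (hbd0 0).sub ((hbd α hα0 (-0)).const_mul _)
  have h2α : (2 * (α:ℂ)) ≠ 0 := by exact_mod_cast (show 2 * α ≠ 0 by positivity)
  have h2α1 : (2 * (α:ℂ) + 1) ≠ 0 := by exact_mod_cast (show 2 * α + 1 ≠ 0 by positivity)
  have h2α2 : ((α:ℂ) + 1) ≠ 0 := by exact_mod_cast (show α + 1 ≠ 0 by positivity)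
  have hPint : ∫ t : ℝ, F (α + t * I) / ((α^2 + t^2 : ℝ) : ℂ) = 2 * Real.pi * (F ((2 * α : ℝ) : ℂ) / (2 * α)) := by
    simp only [hPc]
    rw [integral_sub (hbd0 0) ((hbd α hα0 (-0)).const_mul _), integral_const_mul, h 0,
      lemQ hRH hα hα2 hα0 (by linarith) le_rfl, EE_nonpos le_rfl, H]
    push_cast
    rw [← two_mul]
    simp
    field_simp
  have hPre : ∀ t : ℝ, P t = (F (α + t * I) / ((α^2 + t^2 : ℝ) : ℂ)).re := by
    intro t
    rw [Complex.div_ofReal_re]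
  have hPI : Integrable P := by
    have := hPi.re
    refine this.congr (ae_of_all _ fun t => ?_)
    simp [hPre]
  have hPval : ∫ t, P t = Real.pi * ((F ((2 * α : ℝ) : ℂ)).re / α) := by
    simp only [hPre]
    have := integral_re hPi
    simp only [RCLike.re_eq_complex_re] at this
    rw [this, hPint]
    have e : 2 * (Real.pi:ℂ) * (F ((2 * α : ℝ) : ℂ) / (2 * α)) = ((Real.pi / α : ℝ) : ℂ) * F ((2 * α : ℝ) : ℂ) := by
      have : (α:ℂ) ≠ 0 := by exact_mod_cast hα0.ne'
      push_cast; field_simp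
    rw [e, Complex.re_ofReal_mul]; ring
  -- conjugate pieces
  have hcj : ∀ (c : ℝ) (t : ℝ), (starRingEnd ℂ) (Φ t * cexp (t * (-u:ℝ) * I) * ((c:ℂ) - t * I)⁻¹) =
      (starRingEnd ℂ) (Φ t) * cexp (t * u * I) * ((c:ℂ) + t * I)⁻¹ := by
    intro c t
    simp only [map_mul, map_inv₀, map_sub, conj_ofReal, conj_I, ← Complex.exp_conj]
    congr 2
    · congr 1; push_cast; simp
    · ring
  have hcj0 : ∀ (t : ℝ), (starRingEnd ℂ) (Φ t * cexp (t * (-u:ℝ) * I)) =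
      (starRingEnd ℂ) (Φ t) * cexp (t * u * I) := by
    intro t
    simp only [map_mul, conj_ofReal, conj_I, ← Complex.exp_conj]
    congr 2; push_cast; simp
  have hconjint : ∀ f : ℝ → ℂ, Integrable f → Integrable (fun t => (starRingEnd ℂ) (f t)) := fun f hf =>
    (Complex.conjLIE.integrable_comp_iff (φ := f)).mpr hf
  have I0 : ∫ t : ℝ, (starRingEnd ℂ) (Φ t) * cexp (t * u * I) = 0 := by
    simp only [← hcj0]
    rw [integral_conj, h (-u), EE_nonpos (by linarith)]
    simp
  have I0i : Integrable (fun t : ℝ => (starRingEnd ℂ) (Φ t) * cexp (t * u * I)) := by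
    simp only [← hcj0]
    exact hconjint _ (hbd0 _)
  have Ic : ∀ c : ℝ, 0 < c → 1 < c + α → ∫ t : ℝ, (starRingEnd ℂ) (Φ t) * cexp (t * u * I) * ((c:ℂ) + t * I)⁻¹ =
      2 * Real.pi * (Real.exp (-c * u) * H ((c + α : ℝ) : ℂ)) := by
    intro c hc hcα
    simp only [← hcj]
    rw [integral_conj, lemQ hRH hα hα2 hc hcα hu, H_real hcα]
    simp only [map_mul, conj_ofReal, map_ofNat]
  have Ici : ∀ c : ℝ, 0 < c → Integrable (fun t : ℝ => (starRingEnd ℂ) (Φ t) * cexp (t * u * I) * ((c:ℂ) + t * I)⁻¹) := by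
    intro c hc
    simp only [← hcj]
    exact hconjint _ (hbd c hc _)
  -- the pointwise identity
  have hid : ∀ t : ℝ, Φ t * cexp (t * u * I) + (starRingEnd ℂ) (Φ t) * cexp (t * u * I)
      + (2 * α * (2 * α + 1)) * ((starRingEnd ℂ) (Φ t) * cexp (t * u * I) * ((α:ℂ) + t * I)⁻¹)
      + (-2 * (α + 1) * (2 * α + 1)) * ((starRingEnd ℂ) (Φ t) * cexp (t * u * I) * (((α + 1 : ℝ):ℂ) + t * I)⁻¹)
      = (-2 * ((F (α + t * I)).re : ℂ)) * cexp (t * u * I) * (((α:ℂ) + t * I)⁻¹ * (((α + 1 : ℝ):ℂ) + t * I)⁻¹) := by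
    intro t
    have hre : ((2 * (F (α + t * I)).re : ℝ) : ℂ) = F (α + t * I) + (starRingEnd ℂ) (F (α + t * I)) := (Complex.add_conj _).symm
    have : (-2 * ((F (α + t * I)).re : ℂ)) = -((2 * (F (α + t * I)).re : ℝ) : ℂ) := by push_cast; ring
    rw [this, hre, hk]
    have h1 := c_add_ne hα0 t
    have h2 := c_add_ne hβ0 t
    simp only [map_mul, map_add, map_neg, conj_ofReal, conj_I]
    generalize (starRingEnd ℂ) (Φ t) = p
    generalize Φ t = q
    generalize cexp (t * u * I) = r
    push_cast at h2 ⊢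
    field_simp
    ring
  have hsum : ∫ t : ℝ, (-2 * ((F (α + t * I)).re : ℂ)) * cexp (t * u * I) * (((α:ℂ) + t * I)⁻¹ * (((α + 1 : ℝ):ℂ) + t * I)⁻¹)
      = 2 * Real.pi * (((EE u * Real.exp (-(α + 1) * u) : ℝ) : ℂ) - Real.exp (-α * u) * F ((2 * α : ℝ) : ℂ) +
      Real.exp (-(α+1) * u) * F ((2 * α + 1 : ℝ) : ℂ)) := by
    simp only [← hid]
    rw [integral_add (((hbd0 u).fun_add I0i).fun_add ((Ici α hα0).const_mul _)) ((Ici _ hβ0).const_mul _),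
      integral_add ((hbd0 u).fun_add I0i) ((Ici α hα0).const_mul _), integral_add (hbd0 u) I0i,
      integral_const_mul, integral_const_mul, I0, Ic α hα0 (by linarith), Ic (α+1) hβ0 (by linarith), h u]
    rw [show α + α = 2 * α by ring, show α + 1 + α = 2 * α + 1 by ring, H, H]
    generalize F ((2 * α : ℝ) : ℂ) = f1
    generalize F ((2 * α + 1 : ℝ) : ℂ) = f2
    push_cast
    have : (2 * (α:ℂ) + 1 + 1) ≠ 0 := by
      intro h; apply h2α2; linear_combination h / 2
    have hαc : (α:ℂ) ≠ 0 := by exact_mod_cast hα0.ne'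
    field_simp
    ring
  have hnorm : ‖∫ t : ℝ, (-2 * ((F (α + t * I)).re : ℂ)) * cexp (t * u * I) * (((α:ℂ) + t * I)⁻¹ * (((α + 1 : ℝ):ℂ) + t * I)⁻¹)‖
      ≤ ∫ t : ℝ, 2 * P t := by
    apply norm_integral_le_of_norm_le (hPI.const_mul 2)
    refine ae_of_all _ fun t => ?_
    have hR : 0 ≤ (F (α + t * I)).re := F_re_nonneg hRH (by simpa using hα)
    rw [norm_mul, norm_mul, norm_cexp_I, norm_mul, Complex.norm_real, Real.norm_eq_abs, abs_of_nonneg hR, norm_mul, norm_inv, norm_inv]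
    have n1 : ‖(α:ℂ) + t * I‖^2 = α^2 + t^2 := by
      rw [Complex.sq_norm, Complex.normSq_add_mul_I]
    have n2 : ‖((α + 1 : ℝ):ℂ) + t * I‖^2 = (α+1)^2 + t^2 := by
      rw [Complex.sq_norm, Complex.normSq_add_mul_I]
    have n3 : ‖(α:ℂ) + t * I‖ ≤ ‖((α + 1 : ℝ):ℂ) + t * I‖ := by
      apply le_of_sq_le_sq _ (norm_nonneg _)
      rw [n1, n2]; nlinarith
    have n0 : 0 < ‖(α:ℂ) + t * I‖ := norm_pos_iff.mpr (c_add_ne hα0 t)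
    have n4 : ‖(α:ℂ) + t * I‖⁻¹ * ‖((α + 1 : ℝ):ℂ) + t * I‖⁻¹ ≤ (α^2 + t^2)⁻¹ := by
      rw [← n1, pow_two, mul_inv]
      gcongr
    simp only [hP]
    rw [norm_neg, mul_one, div_eq_mul_inv]
    calc _ ≤ ‖(2:ℂ)‖ * (F (α + t * I)).re * (α^2 + t^2)⁻¹ := by gcongr
      _ = _ := by simp; ring
  rw [hsum, integral_const_mul, hPval, norm_mul] at hnorm
  have hpi : ‖(2 * Real.pi : ℂ)‖ = 2 * Real.pi := by
    rw [norm_mul, Complex.norm_real, Real.norm_eq_abs, abs_of_pos Real.pi_pos]; simp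
  rw [hpi, ← mul_assoc] at hnorm
  exact le_of_mul_le_mul_left hnorm (by positivity)

end PsiRH

namespace PsiRH
open Complex Topology

lemma main_half (hRH : RiemannHypothesis) {u : ℝ} (hu : 0 ≤ u) :
    ‖((EE u * Real.exp (-(1/2 + 1) * u) : ℝ) : ℂ) - Real.exp (-(1/2) * u) * F 1 +
      Real.exp (-(1/2+1) * u) * F 2‖ ≤ (F 1).re / (1/2) := by
  have hF1 : ContinuousAt (fun α : ℝ => F ((2 * α : ℝ) : ℂ)) (1/2) := by
    refine ContinuousAt.comp (g := F) (f := fun α : ℝ => ((2 * α : ℝ) : ℂ)) ?_ (by fun_prop)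
    exact (F_diffAt hRH (by simp; norm_num)).continuousAt
  have hF2 : ContinuousAt (fun α : ℝ => F ((2 * α + 1 : ℝ) : ℂ)) (1/2) := by
    refine ContinuousAt.comp (g := F) (f := fun α : ℝ => ((2 * α + 1 : ℝ) : ℂ)) ?_ (by fun_prop)
    exact (F_diffAt hRH (by simp; norm_num)).continuousAt
  have hl : ContinuousAt (fun α : ℝ => ‖((EE u * Real.exp (-(α + 1) * u) : ℝ) : ℂ) - Real.exp (-α * u) * F ((2 * α : ℝ) : ℂ) +
      Real.exp (-(α+1) * u) * F ((2 * α + 1 : ℝ) : ℂ)‖) (1/2) := by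
    apply ContinuousAt.norm
    apply ContinuousAt.add
    · apply ContinuousAt.sub (by fun_prop)
      exact ContinuousAt.mul (by fun_prop) hF1
    · exact ContinuousAt.mul (by fun_prop) hF2
  have hr : ContinuousAt (fun α : ℝ => (F ((2 * α : ℝ) : ℂ)).re / α) (1/2) := by
    apply ContinuousAt.div _ (by fun_prop) (by norm_num)
    exact Complex.continuous_re.continuousAt.comp hF1
  have hl' := hl.tendsto.mono_left (nhdsWithin_le_nhds (s := Set.Ioi (1/2)))
  have hr' := hr.tendsto.mono_left (nhdsWithin_le_nhds (s := Set.Ioi (1/2)))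
  have := le_of_tendsto_of_tendsto hl' hr' (by
    filter_upwards [self_mem_nhdsWithin, nhdsWithin_le_nhds (Iio_mem_nhds (show (1/2:ℝ) < 2 by norm_num))] with α h1 h2
    exact main_alpha hRH h1 (le_of_lt h2) hu)
  rw [show (((2 * (1/2) : ℝ)) : ℂ) = 1 by norm_num, show (((2 * (1/2) + 1 : ℝ)) : ℂ) = 2 by norm_num] at this
  exact this

lemma main_W (hRH : RiemannHypothesis) {x : ℝ} (hx : 1 ≤ x) :
    |E (Real.log x) - x * (F 1).re + (F 2).re| ≤ 2 * (F 1).re * x ^ ((3:ℝ)/2) := by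
  have hx0 : 0 < x := by linarith
  have hu : 0 ≤ Real.log x := Real.log_nonneg hx
  have h := (Complex.abs_re_le_norm _).trans (main_half hRH hu)
  rw [EE_pos hu] at h
  simp only [Complex.add_re, Complex.sub_re, Complex.re_ofReal_mul, Complex.ofReal_re] at h
  have e1 : x ^ ((3:ℝ)/2) * Real.exp (-(1/2+1) * Real.log x) = 1 := by
    rw [Real.rpow_def_of_pos hx0, ← Real.exp_add]
    rw [Real.exp_eq_one_iff]; ring
  have e2 : x ^ ((3:ℝ)/2) * Real.exp (-(1/2) * Real.log x) = x := by
    rw [Real.rpow_def_of_pos hx0, ← Real.exp_add]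
    nth_rw 3 [← Real.exp_log hx0]
    congr 1; ring
  have hp : 0 < x ^ ((3:ℝ)/2) := by positivity
  have key : E (Real.log x) - x * (F 1).re + (F 2).re = x ^ ((3:ℝ)/2) * (E (Real.log x) * Real.exp (-(1/2+1) * Real.log x)
    - Real.exp (-(1/2) * Real.log x) * (F 1).re + Real.exp (-(1/2+1) * Real.log x) * (F 2).re) := by
    linear_combination (-(E (Real.log x)) - (F 2).re) * e1 + (F 1).re * e2
  rw [key, abs_mul, abs_of_pos hp]
  calc _ ≤ x ^ ((3:ℝ)/2) * ((F 1).re / (1/2)) := by gcongr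
    _ = _ := by ring

lemma psi_integral {x : ℝ} (hx : 2 ≤ x) : ∫ t in (2:ℝ)..x, (psi t - t) = psi1 x - x^2/2 + 2 := by
  have hpsi : ∀ t, psi t = ∑ k ∈ Finset.Icc 0 ⌊t⌋₊, ArithmeticFunction.vonMangoldt k := by
    intro t
    unfold psi
    rw [Finset.Icc_eq_cons_Ioc (Nat.zero_le _), Finset.sum_cons]
    simp
    rfl
  have hd : deriv (fun t : ℝ => x - t) = fun _ => -1 := by
    ext t; simp
  have hA := sum_mul_eq_sub_integral_mul₁ (c := fun n => ArithmeticFunction.vonMangoldt n) (f := fun t : ℝ => x - t)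
    (by simp) (by simp) x (fun t _ => by fun_prop) (by rw [hd]; exact continuousOn_const.integrableOn_Icc)
  have hI := integrableOn_mul_sum_Icc (m := 0) (a := 2) (b := x) (fun n => ArithmeticFunction.vonMangoldt n) (by norm_num)
    (g := fun _ : ℝ => (1:ℝ)) continuousOn_const.integrableOn_Icc
  simp only [one_mul, ← hpsi] at hI
  simp only [hd, ← hpsi, sub_self, zero_mul, zero_sub, neg_mul, one_mul, integral_neg, neg_neg] at hA
  have hii : IntervalIntegrable psi volume 2 x := by
    rw [intervalIntegrable_iff_integrableOn_Icc_of_le hx]; exact hI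
  rw [intervalIntegral.integral_sub hii (by simp), integral_id, intervalIntegral.integral_of_le hx, ← hA,
    psi1_eq x (⌊x⌋₊ + 1) (by push_cast; exact (Nat.lt_floor_add_one x).le)]
  have : ∑ n ∈ Finset.range (⌊x⌋₊ + 1), ArithmeticFunction.vonMangoldt n * max (x - n) 0 =
      ∑ k ∈ Finset.Icc 0 ⌊x⌋₊, (x - k) * ArithmeticFunction.vonMangoldt k := by
    apply Finset.sum_congr
    · ext n; simp
    · intro n hn
      have : (n:ℝ) ≤ x := (Nat.le_floor_iff (by linarith)).mp (by simpa using hn)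
      rw [max_eq_left (by linarith), mul_comm]
  rw [this]; ring

lemma gamma_le (n : ℕ) : Real.eulerMascheroniConstant ≤ harmonic n - Real.log (n + 1/2) := by
  have hanti : Antitone (fun n : ℕ => (harmonic n : ℝ) - Real.log (n + 1/2)) := by
    apply antitone_nat_of_succ_le
    intro n
    have ha : (0:ℝ) < n + 1/2 := by positivity
    have h := Real.hasSum_log_one_add_inv ha
    have h2 := le_hasSum h 0 (fun k _ => by positivity)
    have h3 : Real.log (1 + ((n:ℝ) + 1/2)⁻¹) = Real.log ((n:ℝ) + 1 + 1/2) - Real.log (n + 1/2) := by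
      rw [← Real.log_div (by positivity) (by positivity)]
      congr 1; field_simp; ring
    rw [h3] at h2
    have h4 : (2:ℝ) * (1 / (2 * ((0:ℕ):ℝ) + 1)) * (1 / (2 * ((n:ℝ) + 1/2) + 1)) ^ (2 * 0 + 1) = ((n:ℝ) + 1)⁻¹ := by
      simp; field_simp; ring
    rw [h4] at h2
    rw [harmonic_succ]
    push_cast
    linarith
  apply hanti.le_of_tendsto
  have h1 := Real.tendsto_harmonic_sub_log
  have h2 := (Real.tendsto_log_comp_add_sub_log (1/2)).comp (tendsto_natCast_atTop_atTop (R := ℝ))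
  have := h1.sub h2
  rw [sub_zero] at this
  refine this.congr fun n => ?_
  simp

lemma num1 : 2 + Real.eulerMascheroniConstant - Real.log Real.pi - 2 * Real.log 2 ≤ 0.0463 := by
  have hg := gamma_le 40
  have hH : ((harmonic 40 : ℚ) : ℝ) ≤ 4.278544 := by
    have : harmonic 40 ≤ 4278544/1000000 := by
      norm_num [harmonic, Finset.sum_range_succ]
    have h2 : ((harmonic 40 : ℚ) : ℝ) ≤ ((4278544/1000000 : ℚ) : ℝ) := by exact_mod_cast this
    refine h2.trans ?_
    norm_num
  have hpi := Real.pi_gt_d4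
  have hpi0 := Real.pi_pos
  have l1 : Real.log Real.pi + Real.log ((40:ℕ) + 1/2) = 7 * Real.log 2 + Real.log (81 * Real.pi / 256) := by
    have : (81 * Real.pi / 256) = Real.pi * ((40:ℕ) + 1/2) / 2^7 := by push_cast; ring
    rw [this, Real.log_div (by positivity) (by positivity), Real.log_mul (by positivity) (by positivity), Real.log_pow]
    push_cast; ring
  have l2 := Real.one_sub_inv_le_log_of_pos (show 0 < 81 * Real.pi / 256 by positivity)
  have l3 : (81 * Real.pi / 256)⁻¹ ≤ 1.00605 := by
    rw [inv_le_comm₀ (by positivity) (by norm_num)]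
    have : (1.00605:ℝ)⁻¹ ≤ 0.99399 := by norm_num
    nlinarith
  have := Real.log_two_gt_d9
  linarith

lemma num2 : Real.log 2 + Real.log Real.pi ≤ 1.8382 := by
  have hpi := Real.pi_lt_d4
  have hpi0 := Real.pi_pos
  have h : 3 * (Real.log 2 + Real.log Real.pi) = 8 * Real.log 2 + Real.log (Real.pi^3 / 32) := by
    rw [Real.log_div (by positivity) (by positivity), Real.log_pow, show (32:ℝ) = 2^5 by norm_num, Real.log_pow]
    push_cast; ring
  have h2 := Real.log_le_sub_one_of_pos (show 0 < Real.pi^3/32 by positivity)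
  have h3 : Real.pi^3 ≤ 3.1416^3 := by gcongr
  have := Real.log_two_lt_d9
  norm_num at h3
  linarith

theorem main (hRH : RiemannHypothesis) (x : ℝ) (hx : 3000 ≤ x) :
    |∫ t in (2:ℝ)..x, (psi t - t)| ≤ 0.08 * x ^ ((3:ℝ)/2) := by
  have hx0 : 0 < x := by linarith
  rw [psi_integral (by linarith)]
  have hW := main_W hRH (x := x) (by linarith)
  have hu : 0 ≤ Real.log x := Real.log_nonneg (by linarith)
  have g0 := g_nonneg hu
  have g2 := g_le hu
  have hE : E (Real.log x) = psi1 x - (x-1)^2/2 + kap * (x - 1) - g (Real.log x) := by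
    unfold E; rw [Real.exp_log hx0]
  have hF1 : (F 1).re = 1 + Real.eulerMascheroniConstant/2 - Real.log Real.pi/2 - Real.log 2 := by
    rw [F_one hRH, Complex.ofReal_re]
  have hF2 := F_two_le
  have hF20 : 0 ≤ (F 2).re := F_re_nonneg hRH (by simp; norm_num)
  have hγ := Real.one_half_lt_eulerMascheroniConstant
  have hγ2 := Real.eulerMascheroniConstant_lt_two_thirds
  have n1 := num1
  have n2 := num2
  have hlp : 0 ≤ Real.log Real.pi := Real.log_nonneg (by linarith [Real.pi_gt_three])
  have hl2 := Real.log_two_gt_d9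
  set W := E (Real.log x) - x * (F 1).re + (F 2).re with hWd
  set C := kap + 5/2 + g (Real.log x) - (F 2).re with hC
  have hk : kap = Real.log Real.pi / 2 + Real.eulerMascheroniConstant / 2 := rfl
  have hI : psi1 x - x^2/2 + 2 = W - x * (Real.log 2 + Real.log Real.pi) + C := by
    rw [hWd, hC, hE, hF1, hk]; ring
  have hC0 : 0 ≤ C := by rw [hC, hk]; linarith
  have hC1 : C ≤ x * (Real.log 2 + Real.log Real.pi) := by
    have : C ≤ 10 := by rw [hC, hk]; linarith
    nlinarith
  have hxs : x ^ ((3:ℝ)/2) = x * √x := by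
    rw [Real.sqrt_eq_rpow, show (3:ℝ)/2 = 1 + 1/2 by norm_num, Real.rpow_add hx0, Real.rpow_one]
  have hs : 54.77 ≤ √x := by
    apply Real.le_sqrt_of_sq_le; norm_num; linarith
  have hfin : x * (Real.log 2 + Real.log Real.pi) ≤ 0.0337 * x ^ ((3:ℝ)/2) := by
    rw [hxs]
    have : Real.log 2 + Real.log Real.pi ≤ 0.0337 * √x := by linarith
    nlinarith
  have hp : 0 < x ^ ((3:ℝ)/2) := by positivity
  have hW2 : 2 * (F 1).re * x ^ ((3:ℝ)/2) ≤ 0.0463 * x ^ ((3:ℝ)/2) := by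
    gcongr; rw [hF1]; linarith
  rw [hI]
  rw [abs_le] at hW ⊢
  constructor <;> linarith [hW.1, hW.2]

end PsiRH

theorem abs_integral_psi_sub_id_le (hRH : RiemannHypothesis)
    (x : ℝ) (hx : 3000 ≤ x) :
    |∫ t in (2:ℝ)..x, (psi t - t)| ≤ 0.08 * x ^ ((3:ℝ)/2) := by
  exact PsiRH.main hRH x hx
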